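/- arXiv:1901.04325 — 3 statements merged into one kernel-verified Lean document; each statement's English description precedes it below -/
import Mathlib

section
/- Let h : ℕ → ℕ be any function such that every finite simple graph having a vital linkage with k components has path-width at most h(k). Then h(k) ≥ 2^k − 1 for every k ≥ 1. -/
open SimpleGraph

/-- A tree-decomposition of a (finite) simple graph `G`: a finite tree `T` (on `Fin n`)
together with bags `χ : V(T) → 2^{V(G)}` covering all vertices and all edges, such that for
each vertex `v` the set of tree nodes whose bag contains `v` induces a connected subgraph. -/
structure TreeDecomp {V : Type*} (G : SimpleGraph V) where
  n : ℕ
  T : SimpleGraph (Fin n)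
  isTree : T.IsTree
  bag : Fin n → Finset V
  bag_cover : ∀ v : V, ∃ i, v ∈ bag i
  bag_edge : ∀ ⦃u v : V⦄, G.Adj u v → ∃ i, u ∈ bag i ∧ v ∈ bag i
  bag_conn : ∀ v : V, (T.induce {i | v ∈ bag i}).Connected

/-- The width of a tree-decomposition: `max |χ(t)| - 1`. -/
def TreeDecomp.width {V : Type*} {G : SimpleGraph V} (d : TreeDecomp G) : ℕ :=
  (Finset.univ.sup fun i => (d.bag i).card) - 1

/-- The tree-width of `G`: minimum width over all tree-decompositions. -/
noncomputable def treewidth {V : Type*} (G : SimpleGraph V) : ℕ :=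
  sInf {w | ∃ d : TreeDecomp G, d.width = w}

/-- A simple graph is a path graph if it is isomorphic to a canonical path graph. -/
def IsPathGraph {α : Type*} (T : SimpleGraph α) : Prop :=
  ∃ n : ℕ, Nonempty (T ≃g SimpleGraph.pathGraph n)

/-- The path-width of `G`: minimum width over all tree-decompositions whose tree is a path. -/
noncomputable def pathwidth {V : Type*} (G : SimpleGraph V) : ℕ :=
  sInf {w | ∃ d : TreeDecomp G, IsPathGraph d.T ∧ d.width = w}

/-- The connected component `c` of `H` is a path from `x` to `y`: there is a path `w` from `x`
to `y` whose vertices are exactly the vertices of `c` and whose edges include every edge of `H`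
incident to `c` (so `c`, as a subgraph, is exactly the path `w`). -/
def IsPathComponent {α : Type*} (H : SimpleGraph α) (c : H.ConnectedComponent)
    (x y : α) : Prop :=
  ∃ w : H.Walk x y, w.IsPath ∧ (∀ v, v ∈ w.support ↔ v ∈ c.supp) ∧
    ∀ u v : α, u ∈ c.supp → H.Adj u v → s(u, v) ∈ w.edges

/-- A linkage in `G` is a subgraph each of whose connected components is a path. -/
def IsLinkage {V : Type*} (G : SimpleGraph V) (L : G.Subgraph) : Prop :=
  ∀ c : L.coe.ConnectedComponent, ∃ x y, IsPathComponent L.coe c x y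

/-- The pattern of a linkage: the set of (unordered) pairs `{x, y}` such that some component
of `L` is a path from `x` to `y`. -/
def LinkagePattern {V : Type*} (G : SimpleGraph V) (L : G.Subgraph) : Set (Sym2 V) :=
  {e | ∃ (x y : L.verts) (c : L.coe.ConnectedComponent),
    IsPathComponent L.coe c x y ∧ e = s((x : V), (y : V))}

/-- A linkage `L` in `G` is vital if `V(L) = V(G)` and no other linkage in `G` has the same
pattern as `L`. -/
def IsVitalLinkage {V : Type*} (G : SimpleGraph V) (L : G.Subgraph) : Prop :=
  IsLinkage G L ∧ L.verts = Set.univ ∧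
    ∀ L' : G.Subgraph, IsLinkage G L' → LinkagePattern G L' = LinkagePattern G L → L' = L

/-- Two rows joined by an arc at the left end of the grid: the rows strictly between `2 ^ e` and
`2 ^ (e + 1)` are nested around `3 * 2 ^ (e - 1)`. -/
def LeftTurn (r r' : ℕ) : Prop :=
  r ≠ r' ∧ ∃ e, 2 ^ e < r ∧ 2 ^ e < r' ∧ r + r' = 3 * 2 ^ e

/-- Adjacency along the strands: horizontal edges, arcs at the left end, arcs at the right end. -/
def StrandAdj (k M : ℕ) (x y : ℕ × ℕ) : Prop :=
  (x.1 = y.1 ∧ (x.2 + 1 = y.2 ∨ y.2 + 1 = x.2)) ∨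
  (x.2 = 0 ∧ y.2 = 0 ∧ LeftTurn x.1 y.1) ∨
  (x.2 + 1 = M ∧ y.2 + 1 = M ∧ x.1 ≠ y.1 ∧ x.1 + y.1 = 2 ^ k)

theorem LeftTurn.symm {r r' : ℕ} (h : LeftTurn r r') : LeftTurn r' r := by
  obtain ⟨h, e, h1, h2, h3⟩ := h
  exact ⟨h.symm, e, h2, h1, by omega⟩

theorem StrandAdj.symm {k M : ℕ} {x y : ℕ × ℕ} (h : StrandAdj k M x y) : StrandAdj k M y x := by
  rcases h with h | ⟨h1, h2, h3⟩ | h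
  · left; omega
  · exact .inr (.inl ⟨h2, h1, h3.symm⟩)
  · right; right; omega

theorem StrandAdj.ne {k M : ℕ} {x y : ℕ × ℕ} (h : StrandAdj k M x y) : x ≠ y := by
  rintro rfl
  rcases h with h | ⟨h1, h2, h3⟩ | h
  · omega
  · exact h3.1 rfl
  · omega

/-- The graph on `ℕ × ℕ` (row, column) consisting of the strands together with vertical edges. -/
def foldedGrid (k M : ℕ) : SimpleGraph (ℕ × ℕ) where
  Adj x y := StrandAdj k M x y ∨ (x.2 = y.2 ∧ (x.1 + 1 = y.1 ∨ y.1 + 1 = x.1))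
  symm := ⟨by
    rintro x y (h | h)
    · exact .inl h.symm
    · right; omega⟩
  loopless := ⟨by
    rintro x (h | h)
    · exact h.ne rfl
    · omega⟩

theorem LeftTurn.not_consecutive {r r' : ℕ} (h : LeftTurn r r') :
    r + 1 ≠ r' ∧ r' + 1 ≠ r := by
  obtain ⟨h, e, h1, h2, h3⟩ := h
  cases e with
  | zero => omega
  | succ e => rw [pow_succ] at *; omega

/-- The parity of the number of half-edges of `xy` that cross the vertical line to the left of
column `c` in a row above `u`. Arcs at either end count as two half-edges. -/
def crossing (x y : ℕ × ℕ) (u c : ℕ) : ZMod 2 :=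
  if x.1 = y.1 then (if c = max x.2 y.2 ∧ x.1 < u then 1 else 0)
  else if x.1 + 1 = y.1 ∨ y.1 + 1 = x.1 then 0
  else if c = (if x.2 = 0 then 0 else x.2 + 1) then
    (if x.1 < u then 1 else 0) + (if y.1 < u then 1 else 0)
  else 0

theorem foldedGrid_adj_cases {k M : ℕ} (hk : 1 ≤ k) (hM : 2 ≤ M) {x y : ℕ × ℕ}
    (h : (foldedGrid k M).Adj x y) :
    (x.1 = y.1 ∧ (x.2 + 1 = y.2 ∨ y.2 + 1 = x.2) ∧
      ∀ u c, crossing x y u c = if c = max x.2 y.2 ∧ x.1 < u then 1 else 0) ∨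
    (x.2 = y.2 ∧ (x.1 + 1 = y.1 ∨ y.1 + 1 = x.1) ∧ ∀ u c, crossing x y u c = 0) ∨
    (x.2 = 0 ∧ y.2 = 0 ∧ LeftTurn x.1 y.1 ∧ ∀ u c, crossing x y u c =
      if c = 0 then (if x.1 < u then 1 else 0) + (if y.1 < u then 1 else 0) else 0) ∨
    (x.2 + 1 = M ∧ y.2 + 1 = M ∧ x.1 ≠ y.1 ∧ x.1 + y.1 = 2 ^ k ∧ ∀ u c, crossing x y u c =
      if c = M then (if x.1 < u then 1 else 0) + (if y.1 < u then 1 else 0) else 0) := by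
  rcases h with (h | ⟨h1, h2, h3⟩ | ⟨h1, h2, h3, h4⟩) | h
  · refine .inl ⟨h.1, h.2, fun u c => ?_⟩
    rw [crossing, if_pos h.1]
  · refine .inr (.inr (.inl ⟨h1, h2, h3, fun u c => ?_⟩))
    have := h3.not_consecutive
    rw [crossing, if_neg h3.1, if_neg (by omega), if_pos h1]
  · refine .inr (.inr (.inr ⟨h1, h2, h3, h4, fun u c => ?_⟩))
    obtain ⟨k, rfl⟩ : ∃ j, k = j + 1 := ⟨k - 1, by omega⟩
    rw [pow_succ] at h4
    rw [crossing, if_neg h3, if_neg (by omega),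
      if_neg (by omega : ¬ x.2 = 0), h1]
  · refine .inr (.inl ⟨h.1, h.2, fun u c => ?_⟩)
    rw [crossing, if_neg (by omega), if_pos (by omega)]

/-- Total crossing parity of a walk. -/
def walkCrossing {k M : ℕ} : ∀ {s t : ℕ × ℕ}, (foldedGrid k M).Walk s t → ℕ → ℕ → ZMod 2
  | _, _, .nil, _, _ => 0
  | _, _, .cons (u := x) (v := y) _ p, u, c => crossing x y u c + walkCrossing p u c

/-- A linear identity between crossings that holds for each edge of a walk holds for the walk. -/
theorem walkCrossing_eq_of_forall {k M : ℕ} {s t : ℕ × ℕ} (p : (foldedGrid k M).Walk s t)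
    (u c u' c' : ℕ)
    (h : ∀ x ∈ p.support, ∀ y ∈ p.support, (foldedGrid k M).Adj x y → s(x, y) ∈ p.edges →
      crossing x y u c = crossing x y u' c') :
    walkCrossing p u c = walkCrossing p u' c' := by
  induction p with
  | nil => rfl
  | cons hadj p ih =>
    simp only [walkCrossing]
    rw [h _ (by simp) _ (by simp) hadj (by simp), ih]
    intro x hx y hy hxy he
    exact h x (by simp [hx]) y (by simp [hy]) hxy (by simp [he])

theorem walkCrossing_eq_zero {k M : ℕ} {s t : ℕ × ℕ} (p : (foldedGrid k M).Walk s t)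
    (u c : ℕ)
    (h : ∀ x y, (foldedGrid k M).Adj x y → crossing x y u c = 0) :
    walkCrossing p u c = 0 := by
  induction p with
  | nil => rfl
  | cons hadj p ih => simp only [walkCrossing]; rw [h _ _ hadj, ih, add_zero]

/-- Conservation: crossings to the left and to the right of the part of column `c` above row `u`
agree up to the ends of the walk in that part. -/
theorem walkCrossing_succ {k M : ℕ} (hk : 1 ≤ k) (hM : 2 ≤ M) {s t : ℕ × ℕ}
    (p : (foldedGrid k M).Walk s t) {u c : ℕ} (hc : c < M) (hu : (u, c) ∉ p.support) :
    walkCrossing p u (c + 1) + walkCrossing p u c =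
      (if s.2 = c ∧ s.1 < u then 1 else 0) + (if t.2 = c ∧ t.1 < u then 1 else 0) := by
  induction p with
  | nil => simp only [walkCrossing]; split_ifs <;> decide
  | @cons x y t hadj p ih =>
    simp only [SimpleGraph.Walk.support_cons, List.mem_cons, not_or] at hu
    have ih := ih hu.2
    have hx : ¬ (u = x.1 ∧ c = x.2) := fun h => hu.1 (Prod.ext h.1 h.2)
    have hy : ¬ (u = y.1 ∧ c = y.2) := fun h => hu.2 (by
      have : (u, c) = y := Prod.ext h.1 h.2
      rw [this]; exact p.start_mem_support)
    have key : crossing x y u (c + 1) + crossing x y u c =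
        (if x.2 = c ∧ x.1 < u then 1 else 0) + (if y.2 = c ∧ y.1 < u then 1 else 0) := by
      rcases foldedGrid_adj_cases hk hM hadj with
        ⟨h1, h2, h3⟩ | ⟨h1, h2, h3⟩ | ⟨h1, h2, -, h3⟩ | ⟨h1, h2, -, -, h3⟩ <;>
      · rw [h3, h3]
        clear h3 ih
        split_ifs <;> first | contradiction | omega | decide
    simp only [walkCrossing]
    have two : (if y.2 = c ∧ y.1 < u then (1 : ZMod 2) else 0)
        + (if y.2 = c ∧ y.1 < u then 1 else 0) = 0 := CharTwo.add_self_eq_zero _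
    linear_combination key + ih + two

theorem walkCrossing_right {k M : ℕ} (hk : 1 ≤ k) (hM : 2 ≤ M) {s t : ℕ × ℕ}
    (p : (foldedGrid k M).Walk s t) {u u' : ℕ} (huu : u + u' = 2 ^ k)
    (hu : (u, M - 1) ∉ p.support) (hu' : (u', M - 1) ∉ p.support) (hr : ∀ x ∈ p.support, x.2 < M) :
    walkCrossing p u M = walkCrossing p u' M := by
  apply walkCrossing_eq_of_forall
  intro x hx y hy hadj _
  have hx1 : ¬ (u = x.1 ∧ M = x.2 + 1) := fun h => hu (by
    have : (u, M - 1) = x := Prod.ext h.1 (by simp [h.2]); rwa [this])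
  have hx2 : ¬ (u' = x.1 ∧ M = x.2 + 1) := fun h => hu' (by
    have : (u', M - 1) = x := Prod.ext h.1 (by simp [h.2]); rwa [this])
  have := hr x hx
  have := hr y hy
  rcases foldedGrid_adj_cases hk hM hadj with
    ⟨h1, h2, h3⟩ | ⟨h1, h2, h3⟩ | ⟨h1, h2, -, h3⟩ | ⟨h1, h2, -, h4, h3⟩ <;>
  rw [h3, h3] <;> clear h3 <;> split_ifs <;> first | contradiction | omega | decide

theorem two_pow_trichotomy (a b : ℕ) : a = b ∨ 2 * 2 ^ a ≤ 2 ^ b ∨ 2 * 2 ^ b ≤ 2 ^ a := by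
  rcases lt_trichotomy a b with h | h | h
  · right; left; rw [← pow_succ']; exact Nat.pow_le_pow_right (by norm_num) h
  · exact .inl h
  · right; right; rw [← pow_succ']; exact Nat.pow_le_pow_right (by norm_num) h

theorem walkCrossing_left {k M : ℕ} (hk : 1 ≤ k) (hM : 2 ≤ M) {s t : ℕ × ℕ}
    (p : (foldedGrid k M).Walk s t) {u u' : ℕ} (huu : LeftTurn u u')
    (hu : (u, 0) ∉ p.support) (hu' : (u', 0) ∉ p.support) :
    walkCrossing p u 0 = walkCrossing p u' 0 := by
  apply walkCrossing_eq_of_forall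
  intro x hx y hy hadj _
  have hx1 : ¬ (u = x.1 ∧ x.2 = 0) := fun h => hu (by
    have : (u, 0) = x := Prod.ext h.1 h.2.symm; rwa [this])
  have hx2 : ¬ (u' = x.1 ∧ x.2 = 0) := fun h => hu' (by
    have : (u', 0) = x := Prod.ext h.1 h.2.symm; rwa [this])
  obtain ⟨-, e, a1, a2, a3⟩ := huu
  rcases foldedGrid_adj_cases hk hM hadj with
    ⟨h1, h2, h3⟩ | ⟨h1, h2, h3⟩ | ⟨h1, h2, ⟨-, e', b1, b2, b3⟩, h3⟩ | ⟨h1, h2, -, h4, h3⟩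
  · rw [h3, h3, if_neg (by omega), if_neg (by omega)]
  · rw [h3, h3]
  · rw [h3, h3]
    clear h3
    rcases two_pow_trichotomy e e' with rfl | h | h <;>
    · split_ifs <;> first | contradiction | omega | decide
  · rw [h3, h3, if_neg (by omega), if_neg (by omega)]

theorem walkCrossing_left_two_pow {k M : ℕ} (hk : 1 ≤ k) (hM : 2 ≤ M) {s t : ℕ × ℕ}
    (p : (foldedGrid k M).Walk s t) (e : ℕ) :
    walkCrossing p (2 ^ e) 0 = 0 := by
  apply walkCrossing_eq_zero
  intro x y hadj
  rcases foldedGrid_adj_cases hk hM hadj with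
    ⟨h1, h2, h3⟩ | ⟨h1, h2, h3⟩ | ⟨h1, h2, ⟨-, e', b1, b2, b3⟩, h3⟩ | ⟨h1, h2, -, h4, h3⟩
  · rw [h3, if_neg (by omega)]
  · rw [h3]
  · rw [h3]
    clear h3
    rcases two_pow_trichotomy e e' with rfl | h | h <;>
    · split_ifs <;> first | contradiction | omega | decide
  · rw [h3, if_neg (by omega)]

theorem walkCrossing_zero_row {k M : ℕ} (hk : 1 ≤ k) (hM : 2 ≤ M) {s t : ℕ × ℕ}
    (p : (foldedGrid k M).Walk s t) (c : ℕ) :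
    walkCrossing p 0 c = 0 := by
  apply walkCrossing_eq_zero
  intro x y hadj
  rcases foldedGrid_adj_cases hk hM hadj with
    ⟨-, -, h3⟩ | ⟨-, -, h3⟩ | ⟨-, -, -, h3⟩ | ⟨-, -, -, -, h3⟩ <;> simp [h3]

/-- The edge `xy` has a half-edge in row `x.1` crossing the vertical line left of column `c`. -/
def HalfEdge (k M : ℕ) (x y : ℕ × ℕ) (c : ℕ) : Prop :=
  (x.1 = y.1 ∧ (x.2 + 1 = y.2 ∨ y.2 + 1 = x.2) ∧ c = max x.2 y.2) ∨
  (c = 0 ∧ x.2 = 0 ∧ y.2 = 0 ∧ LeftTurn x.1 y.1) ∨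
  (c = M ∧ x.2 + 1 = M ∧ y.2 + 1 = M ∧ x.1 ≠ y.1 ∧ x.1 + y.1 = 2 ^ k)

theorem exists_halfEdge_of_walkCrossing_ne {k M : ℕ} (hk : 1 ≤ k) (hM : 2 ≤ M) {s t : ℕ × ℕ}
    (p : (foldedGrid k M).Walk s t) {u u' c : ℕ} (huu : u ≤ u')
    (h : walkCrossing p u c ≠ walkCrossing p u' c) :
    ∃ x y, s(x, y) ∈ p.edges ∧ u ≤ x.1 ∧ x.1 < u' ∧ HalfEdge k M x y c := by
  by_contra! hcon
  apply h
  apply walkCrossing_eq_of_forall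
  intro x hx y hy hadj he
  have h1 := hcon x y he
  have h2 := hcon y x (by rwa [Sym2.eq_swap])
  rcases foldedGrid_adj_cases hk hM hadj with
    ⟨a1, a2, h3⟩ | ⟨a1, a2, h3⟩ | ⟨a1, a2, a3, h3⟩ | ⟨a1, a2, a3, a4, h3⟩
  · rw [h3, h3]
    clear h3
    have h1' : u ≤ x.1 → x.1 < u' → ¬ c = max x.2 y.2 :=
      fun g1 g2 g3 => h1 g1 g2 (.inl ⟨a1, a2, g3⟩)
    split_ifs <;> first | contradiction | omega | decide
  · rw [h3, h3]
  · rw [h3, h3]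
    clear h3
    have h1' : u ≤ x.1 → x.1 < u' → ¬ c = 0 :=
      fun g1 g2 g3 => h1 g1 g2 (.inr (.inl ⟨g3, a1, a2, a3⟩))
    have h2' : u ≤ y.1 → y.1 < u' → ¬ c = 0 :=
      fun g1 g2 g3 => h2 g1 g2 (.inr (.inl ⟨g3, a2, a1, a3.symm⟩))
    split_ifs <;> first | contradiction | omega | decide
  · rw [h3, h3]
    clear h3
    have h1' : u ≤ x.1 → x.1 < u' → ¬ c = M :=
      fun g1 g2 g3 => h1 g1 g2 (.inr (.inr ⟨g3, a1, a2, a3, a4⟩))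
    have h2' : u ≤ y.1 → y.1 < u' → ¬ c = M :=
      fun g1 g2 g3 => h2 g1 g2 (.inr (.inr ⟨g3, a2, a1, a3.symm, by omega⟩))
    split_ifs <;> first | contradiction | omega | decide

theorem LeftTurn.unique {r r₁ r₂ : ℕ} (h₁ : LeftTurn r r₁) (h₂ : LeftTurn r r₂) : r₁ = r₂ := by
  obtain ⟨-, e, a1, a2, a3⟩ := h₁
  obtain ⟨-, e', b1, b2, b3⟩ := h₂
  rcases two_pow_trichotomy e e' with rfl | h | h <;> omega

theorem HalfEdge.mem {k M : ℕ} {x y : ℕ × ℕ} {c : ℕ} (h : HalfEdge k M x y c) :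
    (x.1, c - 1) = x ∨ (x.1, c - 1) = y := by
  rcases h with ⟨h1, h2 | h2, h3⟩ | ⟨h1, h2, h3, -⟩ | ⟨h1, h2, h3, -⟩
  · exact .inl (Prod.ext rfl (by simp; omega))
  · exact .inr (Prod.ext h1 (by simp; omega))
  · exact .inl (Prod.ext rfl (by simp; omega))
  · exact .inl (Prod.ext rfl (by simp; omega))

theorem HalfEdge.unique {k M : ℕ} (hM : 2 ≤ M) {x y x' y' : ℕ × ℕ} {c : ℕ}
    (h : HalfEdge k M x y c) (h' : HalfEdge k M x' y' c) (hxx : x'.1 = x.1)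
    (hx : x.2 < M) (hy : y.2 < M) (hx' : x'.2 < M) (hy' : y'.2 < M) : s(x', y') = s(x, y) := by
  have key : (x'.1 = x.1 ∧ x'.2 = x.2 ∧ y'.1 = y.1 ∧ y'.2 = y.2) ∨
      (x'.1 = y.1 ∧ x'.2 = y.2 ∧ y'.1 = x.1 ∧ y'.2 = x.2) := by
    rcases h with ⟨h1, h2, h3⟩ | ⟨h1, h2, h3, h4⟩ | ⟨h1, h2, h3, h4, h5⟩ <;>
    rcases h' with ⟨g1, g2, g3⟩ | ⟨g1, g2, g3, g4⟩ | ⟨g1, g2, g3, g4, g5⟩ <;> try omega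
    rw [hxx] at g4
    have := h4.unique g4
    omega
  rcases key with ⟨a, b, c, d⟩ | ⟨a, b, c, d⟩
  · rw [show x' = x from Prod.ext a b, show y' = y from Prod.ext c d]
  · rw [show x' = y from Prod.ext a b, show y' = x from Prod.ext c d, Sym2.eq_swap]

theorem SimpleGraph.Walk.eq_start_of_forall_edge {V α : Type*} {G : SimpleGraph V} (φ : V → α)
    {s t : V} (p : G.Walk s t)
    (h : ∀ x ∈ p.support, ∀ y ∈ p.support, G.Adj x y → s(x, y) ∈ p.edges → φ x = φ y) :
    ∀ x ∈ p.support, φ x = φ s := by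
  induction p with
  | nil => intro x hx; simp at hx; rw [hx]
  | @cons u v w hadj p ih =>
    intro x hx
    rw [SimpleGraph.Walk.support_cons, List.mem_cons] at hx
    rcases hx with rfl | hx
    · rfl
    · rw [ih (fun a ha b hb hab he => h a (by simp [ha]) b (by simp [hb]) hab (by simp [he])) x hx]
      exact (h u (by simp) v (by simp) hadj (by simp)).symm

/-- The left end of the `v`-th path. -/
def source (v : ℕ) : ℕ × ℕ := (2 ^ v, 0)

/-- The other end of the `v`-th path. -/
def target (k M v : ℕ) : ℕ × ℕ := if v + 1 = k then (2 ^ v, M - 1) else (3 * 2 ^ v, 0)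

/-- Disjoint walks with the prescribed ends in the bounded part of the folded grid. -/
structure Routing (k M : ℕ) where
  path : ∀ v, v < k → (foldedGrid k M).Walk (source v) (target k M v)
  disj : ∀ v w hv hw x, x ∈ (path v hv).support → x ∈ (path w hw).support → v = w
  range : ∀ v hv, ∀ x ∈ (path v hv).support, 0 < x.1 ∧ x.1 < 2 ^ k ∧ x.2 < M

namespace Routing

variable {k M : ℕ} (P : Routing k M)

/-- The `v`-th path uses the half-edge in row `z` left of column `c`. -/
def UsedAt (c z v : ℕ) : Prop :=
  ∃ (hv : v < k) (x y : ℕ × ℕ), s(x, y) ∈ (P.path v hv).edges ∧ x.1 = z ∧ HalfEdge k M x y c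

theorem UsedAt.mem {c z v : ℕ} (h : P.UsedAt c z v) :
    ∃ hv : v < k, (z, c - 1) ∈ (P.path v hv).support := by
  obtain ⟨hv, x, y, he, rfl, hh⟩ := h
  refine ⟨hv, ?_⟩
  rcases hh.mem with h | h <;> rw [h]
  · exact (P.path v hv).fst_mem_support_of_mem_edges he
  · exact (P.path v hv).snd_mem_support_of_mem_edges he

theorem walkCrossing_vertical (hk : 1 ≤ k) (hM : 2 ≤ M) {v : ℕ} (hv : v < k) {r c : ℕ}
    (h : (r, c) ∉ (P.path v hv).support) :
    walkCrossing (P.path v hv) r (c + 1) = walkCrossing (P.path v hv) (r + 1) (c + 1) := by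
  by_contra hne
  obtain ⟨x, y, he, h1, h2, h3⟩ := exists_halfEdge_of_walkCrossing_ne hk hM _ (Nat.le_succ r) hne
  obtain ⟨_, hh⟩ := UsedAt.mem P ⟨hv, x, y, he, (by omega : x.1 = r), h3⟩
  exact h (by simpa using hh)

theorem walkCrossing_column_zero (hk : 1 ≤ k) (hM : 2 ≤ M) {v : ℕ} (hv : v + 1 < k) {u : ℕ}
    (h : (u, 0) ∉ (P.path v (by omega)).support) :
    walkCrossing (P.path v (by omega)) u 1 + walkCrossing (P.path v (by omega)) u 0 =
      (if 2 ^ v < u then 1 else 0) + (if 3 * 2 ^ v < u then 1 else 0) := by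
  have := walkCrossing_succ hk hM (P.path v (by omega)) (by omega) h
  rw [zero_add] at this
  rw [this]
  simp [source, target, show v + 1 ≠ k by omega]

theorem walkCrossing_column_succ (hk : 1 ≤ k) (hM : 2 ≤ M) {v : ℕ} (hv : v + 1 < k) {u c : ℕ}
    (hc : c + 1 < M) (h : (u, c + 1) ∉ (P.path v (by omega)).support) :
    walkCrossing (P.path v (by omega)) u (c + 1 + 1) =
      walkCrossing (P.path v (by omega)) u (c + 1) := by
  have := walkCrossing_succ hk hM (P.path v (by omega)) hc h
  rw [if_neg (by simp [source]), if_neg (by simp [target, show v + 1 ≠ k by omega]), add_zero]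
    at this
  exact CharTwo.add_eq_zero.mp this

theorem side_eq_of_adj (hk : 1 ≤ k) (hM : 2 ≤ M) {v : ℕ} (hv : v + 1 < k) {x y : ℕ × ℕ}
    (hadj : (foldedGrid k M).Adj x y) (hx2 : x.2 < M) (hy2 : y.2 < M)
    (hx : x ∉ (P.path v (by omega)).support) (hy : y ∉ (P.path v (by omega)).support)
    (hblock : x.2 = 0 → y.2 = 0 → LeftTurn x.1 y.1 → 2 ^ (v + 1) < x.1 → ¬ x.1 < 2 ^ (v + 2)) :
    walkCrossing (P.path v (by omega)) x.1 (x.2 + 1) =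
      walkCrossing (P.path v (by omega)) y.1 (y.2 + 1) := by
  obtain ⟨r, c⟩ := x
  obtain ⟨r', c'⟩ := y
  simp only at *
  rcases hadj with (⟨h1, h2 | h2⟩ | ⟨h1, h2, h3⟩ | ⟨h1, h2, h3, h4⟩) | ⟨h1, h2 | h2⟩ <;>
    simp only at *
  · subst h1 h2
    exact (P.walkCrossing_column_succ hk hM hv hy2 hy).symm
  · subst h1 h2
    exact P.walkCrossing_column_succ hk hM hv hx2 hx
  · subst h1 h2
    have e1 := P.walkCrossing_column_zero hk hM hv hx
    have e2 := P.walkCrossing_column_zero hk hM hv hy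
    have e3 := walkCrossing_left hk hM _ h3 hx hy
    have e4 : (if 2 ^ v < r then (1 : ZMod 2) else 0) + (if 3 * 2 ^ v < r then 1 else 0) =
        (if 2 ^ v < r' then 1 else 0) + (if 3 * 2 ^ v < r' then 1 else 0) := by
      have hb := hblock rfl rfl h3
      obtain ⟨-, e, b1, b2, b3⟩ := h3
      rw [pow_succ, pow_succ, pow_succ] at hb
      rcases two_pow_trichotomy e v with rfl | h | h
      · split_ifs <;> first | contradiction | omega | decide
      · split_ifs <;> first | contradiction | omega | decide
      · rcases two_pow_trichotomy e (v + 1) with rfl | h' | h'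
        · rw [pow_succ] at *
          omega
        · rw [pow_succ] at *
          omega
        · rw [pow_succ] at *
          split_ifs <;> first | contradiction | omega | decide
    rw [zero_add]
    rw [e3] at e1
    linear_combination e1 - e2 + e4
  · have : c + 1 = M := h1
    rw [h1, h2]
    refine walkCrossing_right hk hM _ h4 ?_ ?_ fun x hx => (P.range _ _ x hx).2.2
    · rwa [show M - 1 = c by omega]
    · rwa [show M - 1 = c' by omega]
  · subst h1 h2
    exact P.walkCrossing_vertical hk hM _ hx
  · subst h1 h2
    exact (P.walkCrossing_vertical hk hM _ hy).symm

/-- Only the paths `a` with `a + 1 < e` use arcs of the `e`-th block at the left end. -/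
def BlockOwned (e : ℕ) : Prop :=
  ∀ a (ha : a < k), ∀ x y, s(x, y) ∈ (P.path a ha).edges → x.2 = 0 → y.2 = 0 →
    LeftTurn x.1 y.1 → 2 ^ e < x.1 → x.1 < 2 ^ (e + 1) → a + 1 < e

theorem side_eq (hk : 1 ≤ k) (hM : 2 ≤ M) {v a : ℕ} (hv : v + 1 < k) (ha : a < k) (hva : v < a)
    (hown : P.BlockOwned (v + 1)) {x : ℕ × ℕ} (hx : x ∈ (P.path a ha).support) :
    walkCrossing (P.path v (by omega)) x.1 (x.2 + 1) = if a = v + 1 then 1 else 0 := by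
  have hnot : ∀ y ∈ (P.path a ha).support, y ∉ (P.path v (by omega)).support := fun y hy hy' =>
    hva.ne (P.disj _ _ _ _ _ hy' hy)
  have h := (P.path a ha).eq_start_of_forall_edge
    (fun x => walkCrossing (P.path v (by omega)) x.1 (x.2 + 1))
    (fun x hx y hy hadj he => P.side_eq_of_adj hk hM hv hadj (P.range _ _ _ hx).2.2
      (P.range _ _ _ hy).2.2 (hnot x hx) (hnot y hy)
      (fun h1 h2 h3 h4 h5 => by have := hown a ha x y he h1 h2 h3 h4 h5; omega)) x hx
  rw [h]
  have h0 := P.walkCrossing_column_zero hk hM hv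
    (hnot (source a) (P.path a ha).start_mem_support)
  rw [walkCrossing_left_two_pow hk hM, add_zero] at h0
  refine h0.trans ?_
  rcases two_pow_trichotomy a v with rfl | h | h
  · omega
  · have : a < v := (Nat.pow_lt_pow_iff_right (a := 2) (by norm_num)).1
      (by have := Nat.two_pow_pos a; omega)
    omega
  · have hp := Nat.two_pow_pos v
    rcases two_pow_trichotomy a (v + 1) with rfl | h' | h'
    · rw [pow_succ, if_pos (by omega), if_neg (by omega)]; simp
    · rw [pow_succ] at h'; omega
    · have : a ≠ v + 1 := by rintro rfl; have := Nat.two_pow_pos (v + 1); omega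
      rw [pow_succ] at h'
      rw [if_pos (by omega), if_pos (by omega), if_neg this]
      decide

end Routing

/-- Rows marked as in the ruler sequence are far apart, and equality forces all rows in between
to be used. -/
theorem ruler_gap (Mark Used : ℕ → ℕ → Prop) (N : ℕ)
    (hused : ∀ v < N, ∀ z, Used z v → Mark z v)
    (hsep : ∀ v < N, ∀ x y a b, x < y → Mark x a → Mark y b →
      (a = v + 1 ∧ v + 1 < b ∨ b = v + 1 ∧ v + 1 < a) → ∃ z, x < z ∧ z < y ∧ Used z v) :
    ∀ j ≤ N, ∀ x y a b, x < y → Mark x a → Mark y b → (a = j ∧ j < b ∨ b = j ∧ j < a) →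
      x + 2 ^ j ≤ y ∧ (y = x + 2 ^ j → ∀ z, x < z → z < y → ∃ v < j, Used z v) := by
  intro j
  induction j with
  | zero => intro _ x y a b hxy _ _ _; exact ⟨by simpa using hxy, by intro h z; simp at h; omega⟩
  | succ j ih =>
    intro hj x y a b hxy hx hy hab
    obtain ⟨z, hxz, hzy, hz⟩ := hsep j (by omega) x y a b hxy hx hy hab
    have hzm := hused j (by omega) z hz
    obtain ⟨l1, l2⟩ := ih (by omega) x z a j hxz hx hzm (by omega)
    obtain ⟨r1, r2⟩ := ih (by omega) z y j b hzy hzm hy (by omega)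
    rw [pow_succ]
    refine ⟨by omega, fun heq w hxw hwy => ?_⟩
    rcases lt_trichotomy w z with h | rfl | h
    · obtain ⟨v, hv, hu⟩ := l2 (by omega) w hxw h
      exact ⟨v, by omega, hu⟩
    · exact ⟨j, by omega, hz⟩
    · obtain ⟨v, hv, hu⟩ := r2 (by omega) w h hwy
      exact ⟨v, by omega, hu⟩

namespace Routing

variable {k M : ℕ} (P : Routing k M)

/-- Row `z`, at the line left of column `c`, lies on the side of the first `N` paths on which
the path `a` has to be. -/
def Mark (N c z a : ℕ) : Prop :=
  ∀ v (hv : v < k), v < N → v < a → (z, c - 1) ∉ (P.path v hv).support ∧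
    walkCrossing (P.path v hv) z c = if a = v + 1 then 1 else 0

theorem exists_usedAt_of_mark (hk : 1 ≤ k) (hM : 2 ≤ M) {N c v x y a b : ℕ} (hv : v < N)
    (hN : N < k) (hxy : x < y) (hx : P.Mark N c x a) (hy : P.Mark N c y b)
    (hab : a = v + 1 ∧ v + 1 < b ∨ b = v + 1 ∧ v + 1 < a) :
    ∃ z, x < z ∧ z < y ∧ P.UsedAt c z v := by
  obtain ⟨hx1, hx2⟩ := hx v (by omega) hv (by omega)
  obtain ⟨hy1, hy2⟩ := hy v (by omega) hv (by omega)
  have hne : walkCrossing (P.path v (by omega)) x c ≠ walkCrossing (P.path v (by omega)) y c := by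
    rw [hx2, hy2]
    rcases hab with h | h
    · rw [if_pos h.1, if_neg (by omega)]; decide
    · rw [if_pos h.1, if_neg (by omega)]; decide
  obtain ⟨p, q, he, h1, h2, h3⟩ := exists_halfEdge_of_walkCrossing_ne hk hM _ hxy.le hne
  have hu : P.UsedAt c p.1 v := ⟨by omega, p, q, he, rfl, h3⟩
  refine ⟨p.1, lt_of_le_of_ne h1 ?_, h2, hu⟩
  rintro rfl
  exact hx1 (UsedAt.mem P hu).2

theorem notMem_of_mem {v a : ℕ} (hv : v < k) (ha : a < k) (hva : v < a) {x : ℕ × ℕ}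
    (hx : x ∈ (P.path a ha).support) : x ∉ (P.path v hv).support :=
  fun h => hva.ne (P.disj _ _ _ _ _ h hx)

theorem walkCrossing_full (hk : 1 ≤ k) (hM : 2 ≤ M) {v : ℕ} (hv : v + 1 < k) {c : ℕ}
    (hc : c ≤ M) : walkCrossing (P.path v (by omega)) (2 ^ k) c = 0 := by
  have hout : ∀ c, (2 ^ k, c) ∉ (P.path v (by omega)).support := fun c h =>
    lt_irrefl _ (P.range _ _ _ h).2.1
  have h0 : walkCrossing (P.path v (by omega)) (2 ^ k) 0 = 0 := walkCrossing_left_two_pow hk hM _ k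
  cases c with
  | zero => exact h0
  | succ c =>
    induction c with
    | zero =>
      have h := P.walkCrossing_column_zero hk hM hv (hout 0)
      have hp := Nat.two_pow_pos v
      have : 4 * 2 ^ v ≤ 2 ^ k := by
        have := Nat.pow_le_pow_right (n := 2) (by norm_num) (show v + 2 ≤ k by omega)
        rw [pow_add] at this; omega
      rw [h0, add_zero, if_pos (by omega), if_pos (by omega)] at h
      rw [zero_add, h]; decide
    | succ c ih =>
      rw [P.walkCrossing_column_succ hk hM hv (by omega) (hout _), ih (by omega) hout h0]

theorem mark_of_usedAt (hk : 1 ≤ k) (hM : 2 ≤ M) {N c z a : ℕ} (hN : N < k) (hc : 1 ≤ c)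
    (hown : ∀ v < N, P.BlockOwned (v + 1)) (h : P.UsedAt c z a) : P.Mark N c z a := by
  intro v hv hvN hva
  obtain ⟨ha, hz⟩ := UsedAt.mem P h
  refine ⟨P.notMem_of_mem hv ha hva hz, ?_⟩
  have := P.side_eq hk hM (by omega) ha hva (hown v hvN) hz
  rwa [Nat.sub_add_cancel hc] at this

theorem mark_of_mem_left (hk : 1 ≤ k) (hM : 2 ≤ M) {N z a : ℕ} (hN : N < k) (ha : a < k)
    (hown : ∀ v < N, P.BlockOwned (v + 1)) (hz : (z, 0) ∈ (P.path a ha).support)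
    (hlow : ∀ v < N, v < a → 3 * 2 ^ v < z) : P.Mark N 0 z a := by
  intro v hv hvN hva
  have hn := P.notMem_of_mem hv ha hva hz
  refine ⟨hn, ?_⟩
  have h1 := P.side_eq hk hM (by omega) ha hva (hown v hvN) hz
  have h2 := P.walkCrossing_column_zero hk hM (by omega) hn
  have := hlow v hvN hva
  rw [if_pos (by omega), if_pos (by omega)] at h2
  rw [← h1]
  have h3 : (1 : ZMod 2) + 1 = 0 := by decide
  rw [h3] at h2
  exact (CharTwo.add_eq_zero.mp h2).symm

theorem mark_two_pow (hk : 1 ≤ k) (hM : 2 ≤ M) {N e a : ℕ} (hN : N < a) (hNe : N < e)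
    (he : e ≤ k) : P.Mark N 0 (2 ^ e) a := by
  intro v hv hvN hva
  refine ⟨?_, by rw [walkCrossing_left_two_pow hk hM, if_neg (by omega)]⟩
  rcases he.eq_or_lt with rfl | he
  · exact fun h => lt_irrefl _ (P.range _ _ _ h).2.1
  · exact P.notMem_of_mem hv he (by omega) (P.path e he).start_mem_support

theorem block_used (hk : 1 ≤ k) (hM : 2 ≤ M) {E : ℕ} (hE : E + 1 < k)
    (hown : ∀ v < E, P.BlockOwned (v + 1)) {z : ℕ} (h1 : 2 ^ (E + 1) < z)
    (h2 : z < 2 ^ (E + 2)) (h3 : z ≠ 3 * 2 ^ E) : ∃ v < E, P.UsedAt 0 z v := by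
  have hlt : ∀ v < E, 2 * 2 ^ v ≤ 2 ^ E := fun v hv => by
    rw [← pow_succ']; exact Nat.pow_le_pow_right (by norm_num) hv
  have hpos := Nat.two_pow_pos E
  have mT : P.Mark E 0 (3 * 2 ^ E) E := by
    refine P.mark_of_mem_left hk hM (by omega) (by omega) hown ?_ ?_
    · have hend : ∀ q, q = target k M E → q ∈ (P.path E (by omega)).support := by
        rintro _ rfl
        exact (P.path E _).end_mem_support
      exact hend _ (by rw [target, if_neg (by omega)])
    · intro v hv _
      have := hlt v hv
      omega
  have mS := P.mark_two_pow hk hM (N := E) (e := E + 1) (a := E + 1) (by omega) (by omega)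
    (by omega)
  have mS' := P.mark_two_pow hk hM (N := E) (e := E + 2) (a := E + 1) (by omega) (by omega)
    (by omega)
  have key := ruler_gap (fun z a => P.Mark E 0 z a ∧ 2 ^ (E + 1) ≤ z)
    (fun z v => P.UsedAt 0 z v ∧ 2 ^ (E + 1) < z) E ?_ ?_
  rotate_left
  · rintro v hv z ⟨hz, hlow⟩
    obtain ⟨hv', hmem⟩ := UsedAt.mem P hz
    refine ⟨P.mark_of_mem_left hk hM (by omega) hv' hown hmem ?_, hlow.le⟩
    intro w hw _
    have := hlt w hw
    rw [pow_succ] at hlow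
    omega
  · rintro v hv x y a b hxy ⟨hx, hx'⟩ ⟨hy, -⟩ hab
    obtain ⟨z, h1, h2, h3⟩ := P.exists_usedAt_of_mark hk hM hv (by omega) hxy hx hy hab
    exact ⟨z, h1, h2, h3, by omega⟩
  have hp1 : 2 ^ (E + 1) = 2 * 2 ^ E := pow_succ' ..
  have hp2 : 2 ^ (E + 2) = 4 * 2 ^ E := by rw [pow_add]; omega
  rcases lt_or_gt_of_ne h3 with h | h
  · obtain ⟨-, key⟩ := key E le_rfl (2 ^ (E + 1)) _ _ _ (by omega)
      ⟨mS, le_rfl⟩ ⟨mT, by omega⟩ (by omega)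
    obtain ⟨v, hv, hu⟩ := key (by omega) z (by omega) (by omega)
    exact ⟨v, hv, hu.1⟩
  · obtain ⟨-, key⟩ := key E le_rfl _ (2 ^ (E + 2)) _ _ (by omega)
      ⟨mT, by omega⟩ ⟨mS', by omega⟩ (by omega)
    obtain ⟨v, hv, hu⟩ := key (by omega) z (by omega) (by omega)
    exact ⟨v, hv, hu.1⟩

theorem blockOwned (hk : 1 ≤ k) (hM : 2 ≤ M) (E : ℕ) (hE : E + 1 < k) : P.BlockOwned (E + 1) := by
  induction E using Nat.strong_induction_on with
  | _ E ih =>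
    intro a ha x y he hx hy hlt h1 h2
    have h3 : x.1 ≠ 3 * 2 ^ E := by
      obtain ⟨g1, e, g2, g3, g4⟩ := hlt
      intro h
      have hp := Nat.two_pow_pos E
      rcases two_pow_trichotomy e E with rfl | h' | h'
      · omega
      · omega
      · rcases two_pow_trichotomy e (E + 1) with rfl | h' | h'
        · rw [pow_succ] at *; omega
        · rw [pow_succ] at *; omega
        · rw [pow_succ] at *; omega
    obtain ⟨v, hv, hu⟩ := P.block_used hk hM hE (fun v hv => ih v hv (by omega)) h1 h2 h3
    obtain ⟨hv', hmem⟩ := UsedAt.mem P hu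
    have hx' : x = (x.1, 0) := Prod.ext rfl hx
    have hmem' := (P.path a ha).fst_mem_support_of_mem_edges he
    rw [hx'] at hmem'
    have := P.disj _ _ _ _ _ hmem hmem'
    omega

theorem mark_end (hk : 1 ≤ k) (hM : 2 ≤ M) {c : ℕ} (hc : c ≤ M) {z : ℕ}
    (hz : z = 0 ∨ z = 2 ^ k) : P.Mark (k - 1) c z k := by
  intro v hv hvN hva
  rcases hz with rfl | rfl
  · refine ⟨fun h => absurd (P.range _ _ _ h).1 (lt_irrefl _), ?_⟩
    rw [walkCrossing_zero_row hk hM, if_neg (by omega)]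
  · refine ⟨fun h => lt_irrefl _ (P.range _ _ _ h).2.1, ?_⟩
    rw [P.walkCrossing_full hk hM (by omega) hc, if_neg (by omega)]

theorem used_of_mark (hk : 1 ≤ k) (hM : 2 ≤ M) {c : ℕ} (hc1 : 1 ≤ c) (hc : c ≤ M) {m : ℕ}
    (hm : P.Mark (k - 1) c m (k - 1)) (hm0 : 0 < m) (hmk : m < 2 ^ k) {z : ℕ} (hz0 : 0 < z)
    (hzk : z < 2 ^ k) (hzm : z ≠ m) : ∃ v, P.UsedAt c z v := by
  have hown : ∀ v < k - 1, P.BlockOwned (v + 1) := fun v hv => P.blockOwned hk hM v (by omega)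
  have key := ruler_gap (P.Mark (k - 1) c) (P.UsedAt c) (k - 1)
    (fun v hv z hz => P.mark_of_usedAt hk hM (Nat.sub_lt hk one_pos) hc1 hown hz)
    (fun v hv x y a b hxy hx hy hab =>
      P.exists_usedAt_of_mark hk hM hv (by omega) hxy hx hy hab)
    (k - 1) le_rfl
  obtain ⟨l1, l2⟩ := key 0 m _ _ hm0 (P.mark_end hk hM hc (.inl rfl)) hm (by omega)
  obtain ⟨r1, r2⟩ := key m (2 ^ k) _ _ hmk hm (P.mark_end hk hM hc (.inr rfl)) (by omega)
  have hpow : 2 ^ k = 2 * 2 ^ (k - 1) := by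
    rw [← pow_succ']; congr 1; omega
  rcases lt_or_gt_of_ne hzm with h | h
  · obtain ⟨v, -, hv⟩ := l2 (by omega) z hz0 h
    exact ⟨v, hv⟩
  · obtain ⟨v, -, hv⟩ := r2 (by omega) z h hzk
    exact ⟨v, hv⟩

theorem used_interior (hk : 1 ≤ k) (hM : 2 ≤ M) {c : ℕ} (hc1 : 1 ≤ c) (hc : c < M) {z : ℕ}
    (hz0 : 0 < z) (hzk : z < 2 ^ k) : ∃ v, P.UsedAt c z v := by
  have hkk : k - 1 < k := by omega
  have hown : ∀ v < k - 1, P.BlockOwned (v + 1) := fun v hv => P.blockOwned hk hM v (by omega)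
  have hlt : 2 ^ (k - 1) < 2 ^ k := Nat.pow_lt_pow_right (by norm_num) hkk
  have hone : walkCrossing (P.path (k - 1) hkk) (2 ^ k) c = 1 := by
    have step : ∀ c < M, walkCrossing (P.path (k - 1) hkk) (2 ^ k) (c + 1) +
        walkCrossing (P.path (k - 1) hkk) (2 ^ k) c =
        (if 0 = c then 1 else 0) + (if M - 1 = c then 1 else 0) := by
      intro c hc
      have h := walkCrossing_succ hk hM (P.path (k - 1) hkk) hc
        (fun h => lt_irrefl _ (P.range _ _ _ h).2.1 : (2 ^ k, c) ∉ _)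
      simpa [source, target, show k - 1 + 1 = k by omega, hlt] using h
    have h0 : walkCrossing (P.path (k - 1) hkk) (2 ^ k) 0 = 0 :=
      walkCrossing_left_two_pow hk hM _ k
    obtain ⟨c, rfl⟩ : ∃ d, c = d + 1 := ⟨c - 1, by omega⟩
    clear hc1
    induction c with
    | zero =>
      have h := step 0 (by omega)
      rwa [h0, if_pos rfl, if_neg (by omega), add_zero, add_zero] at h
    | succ c ih =>
      have h := step (c + 1) (by omega)
      rw [ih (by omega), if_neg (by omega), if_neg (by omega), add_zero] at h
      exact CharTwo.add_eq_zero.mp h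
  obtain ⟨x, y, he, h1, h2, h3⟩ := exists_halfEdge_of_walkCrossing_ne hk hM
    (P.path (k - 1) hkk) (u := 0) (u' := 2 ^ k) (c := c) (by omega)
    (by rw [walkCrossing_zero_row hk hM, hone]; decide)
  have hu : P.UsedAt c x.1 (k - 1) := ⟨hkk, x, y, he, rfl, h3⟩
  by_cases hzx : z = x.1
  · exact ⟨_, hzx ▸ hu⟩
  · exact P.used_of_mark hk hM hc1 hc.le (P.mark_of_usedAt hk hM hkk hc1 hown hu)
      (P.range _ _ _ ((P.path _ _).fst_mem_support_of_mem_edges he)).1 h2 hz0 hzk hzx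

theorem used_right (hk : 1 ≤ k) (hM : 2 ≤ M) {z : ℕ}
    (hz0 : 0 < z) (hzk : z < 2 ^ k) (hz : z ≠ 2 ^ (k - 1)) : ∃ v, P.UsedAt M z v := by
  have hkk : k - 1 < k := by omega
  have hown : ∀ v < k - 1, P.BlockOwned (v + 1) := fun v hv => P.blockOwned hk hM v (by omega)
  refine P.used_of_mark hk hM (by omega) le_rfl ?_ (Nat.two_pow_pos _)
    (Nat.pow_lt_pow_right (by norm_num) hkk) hz0 hzk hz
  intro v hv hvN hva
  have hmem : (2 ^ (k - 1), M - 1) ∈ (P.path (k - 1) hkk).support := by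
    have hend : ∀ q, q = target k M (k - 1) → q ∈ (P.path (k - 1) hkk).support := by
      rintro _ rfl
      exact (P.path _ _).end_mem_support
    exact hend _ (by rw [target, if_pos (by omega)])
  refine ⟨P.notMem_of_mem hv hkk hva hmem, ?_⟩
  have := P.side_eq hk hM (by omega) hkk hva (hown v hvN) hmem
  rwa [Nat.sub_add_cancel (by omega)] at this

theorem used_left (hk : 1 ≤ k) (hM : 2 ≤ M) {r r' : ℕ} (h : LeftTurn r r')
    (hr : r < 2 ^ k) (hr' : r' < 2 ^ k) : ∃ v, P.UsedAt 0 r v := by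
  obtain ⟨h0, e, h1, h2, h3⟩ := h
  cases e with
  | zero => omega
  | succ E =>
    have hE : E + 1 < k := (Nat.pow_lt_pow_iff_right (a := 2) (by norm_num)).1 (by omega)
    rw [pow_succ] at h3
    obtain ⟨v, -, hv⟩ := P.block_used hk hM hE (fun v hv => P.blockOwned hk hM v (by omega)) h1
      (by rw [pow_succ] at *; rw [pow_succ]; omega) (by omega)
    exact ⟨v, hv⟩

/-- Every strand edge is used by a routing. -/
theorem mem_edges_of_strandAdj (hk : 1 ≤ k) (hM : 2 ≤ M) {x y : ℕ × ℕ} (h : StrandAdj k M x y)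
    (hx : 0 < x.1 ∧ x.1 < 2 ^ k ∧ x.2 < M) (hy : 0 < y.1 ∧ y.1 < 2 ^ k ∧ y.2 < M) :
    ∃ v hv, s(x, y) ∈ (P.path v hv).edges := by
  have key : ∃ c v, P.UsedAt c x.1 v ∧ HalfEdge k M x y c := by
    rcases h with ⟨h1, h2⟩ | ⟨h1, h2, h3⟩ | ⟨h1, h2, h3, h4⟩
    · obtain ⟨v, hv⟩ := P.used_interior hk hM (c := max x.2 y.2) (by omega) (by omega) hx.1 hx.2.1
      exact ⟨_, v, hv, .inl ⟨h1, h2, rfl⟩⟩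
    · obtain ⟨v, hv⟩ := P.used_left hk hM h3 hx.2.1 hy.2.1
      exact ⟨_, v, hv, .inr (.inl ⟨rfl, h1, h2, h3⟩)⟩
    · have hpow : 2 ^ k = 2 * 2 ^ (k - 1) := by
        rw [← pow_succ']; congr 1; omega
      obtain ⟨v, hv⟩ := P.used_right hk hM hx.1 hx.2.1 (by omega)
      exact ⟨_, v, hv, .inr (.inr ⟨rfl, h1, h2, h3, h4⟩)⟩
  obtain ⟨c, v, ⟨hv, x', y', he, hxx, hh'⟩, hh⟩ := key
  refine ⟨v, hv, ?_⟩
  rwa [← hh.unique hM hh' hxx hx.2.2 hy.2.2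
    (P.range _ _ _ ((P.path _ _).fst_mem_support_of_mem_edges he)).2.2
    (P.range _ _ _ ((P.path _ _).snd_mem_support_of_mem_edges he)).2.2]

end Routing

/-- The part of the plane occupied by the grid with `2 ^ k - 1` rows and `2 ^ k` columns. -/
abbrev GridVertex (k : ℕ) : Type := {p : ℕ × ℕ // 0 < p.1 ∧ p.1 < 2 ^ k ∧ p.2 < 2 ^ k}

instance (k : ℕ) : Finite (GridVertex k) :=
  Set.Finite.to_subtype (((Set.finite_Iio (2 ^ k)).prod (Set.finite_Iio (2 ^ k))).subset
    fun _ h => ⟨h.2.1, h.2.2⟩)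

/-- The folded grid with `2 ^ k - 1` rows and `2 ^ k` columns. -/
def boundedGrid (k : ℕ) : SimpleGraph (GridVertex k) := (foldedGrid k (2 ^ k)).comap Subtype.val

/-- A set of vertices that cannot be split into two parts without edges between them. -/
def SimpleGraph.ConnectedOn {V : Type*} (G : SimpleGraph V) (X : Set V) : Prop :=
  ∀ Q : V → Prop, (∀ u ∈ X, ∀ v ∈ X, G.Adj u v → Q u → Q v) → ∀ u ∈ X, ∀ v ∈ X, Q u → Q v

theorem SimpleGraph.pathGraph_connected_between {n : ℕ} {S : Set (Fin n)}
    (h : ((SimpleGraph.pathGraph n).induce S).Preconnected) {i j l : Fin n} (hi : i ∈ S)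
    (hl : l ∈ S) (hij : i ≤ j) (hjl : j ≤ l) : j ∈ S := by
  by_contra hj
  obtain ⟨p⟩ := h ⟨i, hi⟩ ⟨l, hl⟩
  have key : ∀ {a b : S} (p : ((SimpleGraph.pathGraph n).induce S).Walk a b),
      a.1 ≤ j → b.1 ≤ j := by
    intro a b p
    induction p with
    | nil => exact id
    | @cons a b c hadj p ih =>
      intro ha
      apply ih
      have h1 : a.1 ≠ j := fun h => hj (h ▸ a.2)
      have h2 : b.1 ≠ j := fun h => hj (h ▸ b.2)
      rw [SimpleGraph.comap_adj, SimpleGraph.pathGraph_adj] at hadj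
      simp only [Function.Embedding.subtype_apply] at hadj
      omega
  have h1 := key p hij
  exact hj (le_antisymm hjl h1 ▸ hl)

namespace TreeDecomp

variable {V : Type*} {G : SimpleGraph V} (d : TreeDecomp G)

/-- In a path-decomposition some bag meets all members of a finite family of pairwise touching
connected sets. -/
theorem exists_bag_hitting (hd : IsPathGraph d.T) {F : Set (Set V)} (hF : F.Finite)
    (hne : F.Nonempty) (hconn : ∀ X ∈ F, G.ConnectedOn X)
    (htouch : ∀ X ∈ F, ∀ Y ∈ F, ∃ u ∈ X, ∃ v ∈ Y, u = v ∨ G.Adj u v) :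
    ∃ t, ∀ X ∈ F, ∃ v ∈ X, v ∈ d.bag t := by
  classical
  obtain ⟨n, ⟨e⟩⟩ := hd
  let B : Fin n → Finset V := fun i => d.bag (e.symm i)
  have hcover : ∀ v, ∃ i, v ∈ B i := fun v => by
    obtain ⟨i, hi⟩ := d.bag_cover v
    exact ⟨e i, by simpa [B] using hi⟩
  have hedge : ∀ u v, u = v ∨ G.Adj u v → ∃ i, u ∈ B i ∧ v ∈ B i := by
    rintro u v (rfl | h)
    · simpa using hcover u
    · obtain ⟨i, hi⟩ := d.bag_edge h
      exact ⟨e i, by simpa [B] using hi⟩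
  have hint : ∀ v i j l, v ∈ B i → v ∈ B l → i ≤ j → j ≤ l → v ∈ B j := by
    intro v i j l hi hl hij hjl
    have hpre : ((SimpleGraph.pathGraph n).induce {i | v ∈ B i}).Preconnected := by
      have h := (d.bag_conn v).preconnected
      let f : d.T.induce {i | v ∈ d.bag i} →g (SimpleGraph.pathGraph n).induce {i | v ∈ B i} :=
        { toFun := fun x => ⟨e x.1, by
            have := x.2
            rwa [Set.mem_ofPred_eq, ← e.symm_apply_apply x.1] at this⟩
          map_rel' := fun {a b} hab => e.map_rel_iff.2 hab }
      refine h.map f ?_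
      rintro ⟨x, hx⟩
      exact ⟨⟨e.symm x, hx⟩, Subtype.ext (e.apply_symm_apply x)⟩
    exact SimpleGraph.pathGraph_connected_between hpre hi hl hij hjl
  have hhit : ∀ X ∈ F, ∀ i j l, (∃ v ∈ X, v ∈ B i) → (∃ v ∈ X, v ∈ B l) → i ≤ j → j ≤ l →
      ∃ v ∈ X, v ∈ B j := by
    rintro X hX i j l ⟨u, hu, hui⟩ ⟨v, hv, hvl⟩ hij hjl
    by_contra! hcon
    have hlt : ∀ m, m ≤ j → ∀ w ∈ X, w ∈ B m → m < j := fun m hm w hw hwm =>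
      lt_of_le_of_ne hm (by rintro rfl; exact hcon w hw hwm)
    obtain ⟨m, hm, hvm⟩ := hconn X hX (fun w => ∃ m < j, w ∈ B m) (by
      rintro a ha b hb hab ⟨m, hm, ham⟩
      obtain ⟨m', h1, h2⟩ := hedge a b (.inr hab)
      rcases le_total m' j with h | h
      · exact ⟨m', hlt m' h a ha h1, h2⟩
      · exact absurd (hint a m j m' ham h1 hm.le h) (hcon a ha)) u hu v hv
        ⟨i, hlt i hij u hu hui, hui⟩
    exact hcon v hv (hint v m j l hvm hvl hm.le hjl)
  have hmin : ∀ X ∈ F, ∃ i, (∃ v ∈ X, v ∈ B i) ∧ ∀ j, (∃ v ∈ X, v ∈ B j) → i ≤ j := by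
    intro X hX
    obtain ⟨u, hu, -⟩ := htouch X hX X hX
    obtain ⟨i, hi⟩ := hcover u
    obtain ⟨m, hm, hm'⟩ := WellFounded.has_min (wellFounded_lt (α := Fin n))
      {i | ∃ v ∈ X, v ∈ B i} ⟨i, u, hu, hi⟩
    exact ⟨m, hm, fun j hj => not_lt.1 (hm' j hj)⟩
  have : Nonempty (Fin n) := by
    obtain ⟨X, hX⟩ := hne
    obtain ⟨u, -⟩ := htouch X hX X hX
    exact ⟨(hcover u).choose⟩
  choose! a ha ha' using hmin
  obtain ⟨X, hX, hmax⟩ := hF.exists_maximalFor a F hne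
  refine ⟨e.symm (a X), fun Y hY => ?_⟩
  obtain ⟨u, hu, v, hv, huv⟩ := htouch X hX Y hY
  obtain ⟨p, hp, hp'⟩ := hedge u v huv
  refine hhit Y hY (a Y) (a X) p (ha Y hY) ⟨v, hv, hp'⟩ ?_ (ha' X hX p ⟨u, hu, hp⟩)
  exact (le_total (a X) (a Y)).elim (fun h => hmax hY h) id

/-- The decomposition with a single bag. -/
noncomputable def trivial [Fintype V] (G : SimpleGraph V) : TreeDecomp G where
  n := 1
  T := SimpleGraph.pathGraph 1
  isTree := ⟨SimpleGraph.pathGraph_connected 0, SimpleGraph.IsAcyclic.of_subsingleton⟩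
  bag _ := Finset.univ
  bag_cover v := ⟨0, Finset.mem_univ v⟩
  bag_edge u v _ := ⟨0, Finset.mem_univ u, Finset.mem_univ v⟩
  bag_conn v := by
    have : Nonempty {i : Fin 1 | v ∈ (Finset.univ : Finset V)} := ⟨⟨0, by simp⟩⟩
    exact SimpleGraph.Connected.of_subsingleton

end TreeDecomp

theorem le_pathwidth {V : Type*} [Fintype V] {G : SimpleGraph V} {w : ℕ}
    (h : ∀ d : TreeDecomp G, IsPathGraph d.T → ∃ t, w + 1 ≤ (d.bag t).card) : w ≤ pathwidth G := by
  refine le_csInf ⟨_, TreeDecomp.trivial G, ⟨1, ⟨SimpleGraph.Iso.refl⟩⟩, rfl⟩ ?_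
  rintro _ ⟨d, hd, rfl⟩
  obtain ⟨t, ht⟩ := h d hd
  have := Finset.le_sup (f := fun i => (d.bag i).card) (Finset.mem_univ t)
  rw [TreeDecomp.width]
  omega

theorem Nat.iff_of_forall_succ {Q : ℕ → Prop} {b : ℕ} (a : ℕ)
    (h : ∀ i, a ≤ i → i + 1 < b → (Q i ↔ Q (i + 1))) {i : ℕ} (hi : a ≤ i) (hib : i < b) :
    Q i ↔ Q a := by
  induction i, hi using Nat.le_induction with
  | base => rfl
  | succ i hi ih => rw [← h i hi hib, ih (by omega)]

/-- The row `r` without its last vertex. -/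
def gridRow (k r : ℕ) : Set (GridVertex k) := {p | p.1.1 = r ∧ p.1.2 + 1 < 2 ^ k}

/-- The column `c` restricted to the rows below `b`. -/
def gridColumn (k c b : ℕ) : Set (GridVertex k) := {p | p.1.2 = c ∧ p.1.1 < b}

theorem boundedGrid_row_iff {k r : ℕ} {X : Set (GridVertex k)} {Q : GridVertex k → Prop}
    (hX : gridRow k r ⊆ X)
    (hQ : ∀ u ∈ X, ∀ v ∈ X, (boundedGrid k).Adj u v → Q u → Q v) (hr0 : 0 < r) (hr : r < 2 ^ k)
    {c c' : ℕ} (hc : c + 1 < 2 ^ k) (hc' : c' + 1 < 2 ^ k) :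
    Q ⟨(r, c), hr0, hr, by omega⟩ ↔ Q ⟨(r, c'), hr0, hr, by omega⟩ := by
  have key : ∀ c (hc : c + 1 < 2 ^ k), (∀ h, Q ⟨(r, c), h⟩) ↔ (∀ h, Q ⟨(r, 0), h⟩) := by
    intro c hc
    refine Nat.iff_of_forall_succ (Q := fun c => ∀ h, Q ⟨(r, c), h⟩) (b := 2 ^ k - 1) 0 ?_
      (Nat.zero_le _) (by omega)
    intro i _ hi
    have h1 : (⟨(r, i), hr0, hr, by omega⟩ : GridVertex k) ∈ X := hX ⟨rfl, by simp; omega⟩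
    have h2 : (⟨(r, i + 1), hr0, hr, by omega⟩ : GridVertex k) ∈ X := hX ⟨rfl, by simp; omega⟩
    exact ⟨fun h _ => hQ _ h1 _ h2 (.inl (.inl ⟨rfl, .inl rfl⟩)) (h _),
      fun h _ => hQ _ h2 _ h1 (.inl (.inl ⟨rfl, .inr rfl⟩)) (h _)⟩
  have h1 := key c hc
  have h2 := key c' hc'
  exact ⟨fun h => h2.2 (h1.1 fun _ => h) _, fun h => h1.2 (h2.1 fun _ => h) _⟩

theorem boundedGrid_column_iff {k c b : ℕ} {X : Set (GridVertex k)} {Q : GridVertex k → Prop}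
    (hX : gridColumn k c b ⊆ X)
    (hQ : ∀ u ∈ X, ∀ v ∈ X, (boundedGrid k).Adj u v → Q u → Q v) (hc : c < 2 ^ k) (hb : b ≤ 2 ^ k)
    {r r' : ℕ} (hr0 : 0 < r) (hr : r < b) (hr0' : 0 < r') (hr' : r' < b) :
    Q ⟨(r, c), hr0, by omega, hc⟩ ↔ Q ⟨(r', c), hr0', by omega, hc⟩ := by
  have key : ∀ r (hr0 : 0 < r) (hr : r < b), (∀ h, Q ⟨(r, c), h⟩) ↔ (∀ h, Q ⟨(1, c), h⟩) := by
    intro r hr0 hr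
    refine Nat.iff_of_forall_succ (Q := fun r => ∀ h, Q ⟨(r, c), h⟩) (b := b) 1 ?_ hr0 hr
    intro i hi hib
    have h1 : (⟨(i, c), hi, by omega, hc⟩ : GridVertex k) ∈ X := hX ⟨rfl, by simp; omega⟩
    have h2 : (⟨(i + 1, c), by omega, by omega, hc⟩ : GridVertex k) ∈ X := hX ⟨rfl, by simpa⟩
    exact ⟨fun h _ => hQ _ h1 _ h2 (.inr ⟨rfl, .inl rfl⟩) (h _),
      fun h _ => hQ _ h2 _ h1 (.inr ⟨rfl, .inr rfl⟩) (h _)⟩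
  have h1 := key r hr0 hr
  have h2 := key r' hr0' hr'
  exact ⟨fun h => h2.2 (h1.1 fun _ => h) _, fun h => h1.2 (h2.1 fun _ => h) _⟩

theorem connectedOn_gridRow {k r : ℕ} : (boundedGrid k).ConnectedOn (gridRow k r) := by
  rintro Q hQ ⟨⟨a, c⟩, h0, h1, h2⟩ ⟨rfl : a = r, hu⟩ ⟨⟨a', c'⟩, h0', h1', h2'⟩
    ⟨rfl : a' = a, hv⟩ h
  exact (boundedGrid_row_iff subset_rfl hQ h0 h1 hu hv).1 h

theorem connectedOn_gridColumn {k c b : ℕ} (hb : b ≤ 2 ^ k) :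
    (boundedGrid k).ConnectedOn (gridColumn k c b) := by
  rintro Q hQ ⟨⟨a, d⟩, h0, h1, h2⟩ ⟨rfl : d = c, hu⟩ ⟨⟨a', d'⟩, h0', h1', h2'⟩
    ⟨rfl : d' = d, hv⟩ h
  exact (boundedGrid_column_iff subset_rfl hQ h2 hb h0 hu h0' hv).1 h

theorem connectedOn_gridCross {k r c b : ℕ} (hb : b ≤ 2 ^ k) (hr0 : 0 < r) (hr : r < b)
    (hc : c + 1 < 2 ^ k) : (boundedGrid k).ConnectedOn (gridRow k r ∪ gridColumn k c b) := by
  intro Q hQ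
  have key : ∀ u ∈ gridRow k r ∪ gridColumn k c b,
      (Q u ↔ Q ⟨(r, c), hr0, by omega, by omega⟩) := by
    rintro ⟨⟨a, d⟩, h0, h1, h2⟩ (⟨rfl : a = r, hu⟩ | ⟨rfl : d = c, hu⟩)
    · exact boundedGrid_row_iff Set.subset_union_left hQ h0 h1 hu hc
    · exact boundedGrid_column_iff Set.subset_union_right hQ h2 hb h0 hu hr0 hr
  exact fun u hu v hv h => (key v hv).2 ((key u hu).1 h)

theorem two_pow_sub_one_le_pathwidth {k : ℕ} (hk : 1 ≤ k) [Fintype (GridVertex k)] :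
    2 ^ k - 1 ≤ pathwidth (boundedGrid k) := by
  classical
  apply le_pathwidth
  intro d hd
  have hpow : 2 ≤ 2 ^ k := by simpa using Nat.pow_le_pow_right (n := 2) (by norm_num) hk
  set M := 2 ^ k with hM
  let F : Set (Set (GridVertex k)) := {X | X = gridColumn k (M - 1) M ∨ X = gridRow k (M - 1) ∨
    ∃ r c, 0 < r ∧ r + 1 < M ∧ c + 1 < M ∧ X = gridRow k r ∪ gridColumn k c (M - 1)}
  obtain ⟨t, ht⟩ := d.exists_bag_hitting hd (F := F) (Set.toFinite _) ⟨_, .inl rfl⟩ (by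
    rintro X (rfl | rfl | ⟨r, c, h1, h2, h3, rfl⟩)
    · exact connectedOn_gridColumn le_rfl
    · exact connectedOn_gridRow
    · exact connectedOn_gridCross (by omega) h1 (by omega) h3) (by
    have hcol : ∀ r (h0 : 0 < r) (h1 : r < M),
        (⟨(r, M - 1), h0, h1, by omega⟩ : GridVertex k) ∈ gridColumn k (M - 1) M :=
      fun r _ h1 => ⟨rfl, h1⟩
    have hrow : ∀ r c (h0 : 0 < r) (h1 : r < M) (hc : c + 1 < M),
        (⟨(r, c), h0, h1, by omega⟩ : GridVertex k) ∈ gridRow k r := fun r c _ _ hc => ⟨rfl, hc⟩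
    have hcr : ∀ r c (h0 : 0 < r) (h1 : r < M - 1) (hc : c < M),
        (⟨(r, c), h0, by omega, by omega⟩ : GridVertex k) ∈ gridColumn k c (M - 1) :=
      fun r c _ h1 _ => ⟨rfl, h1⟩
    have hadj₁ : ∀ r (h0 : 0 < r) (h1 : r < M), (boundedGrid k).Adj
        ⟨(r, M - 1), h0, h1, by omega⟩ ⟨(r, M - 2), h0, h1, by omega⟩ :=
      fun r _ _ => .inl (.inl ⟨rfl, .inr (by simp; omega)⟩)
    have hadj₂ : ∀ c (hc : c < M) (hM : 2 < M), (boundedGrid k).Adj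
        ⟨(M - 1, c), by omega, by omega, hc⟩ ⟨(M - 2, c), by omega, by omega, hc⟩ :=
      fun c _ _ => .inr ⟨rfl, .inr (by simp; omega)⟩
    have h₀ : 0 < M - 1 := by omega
    have hl : M - 1 < M := by omega
    have hl' : M - 2 + 1 < M := by omega
    rintro X (rfl | rfl | ⟨r, c, h1, h2, h3, rfl⟩) Y (rfl | rfl | ⟨r', c', h1', h2', h3', rfl⟩)
    · exact ⟨_, hcol 1 one_pos hpow, _, hcol 1 one_pos hpow, .inl rfl⟩
    · exact ⟨_, hcol (M - 1) h₀ hl, _, hrow (M - 1) (M - 2) h₀ hl hl', .inr (hadj₁ _ h₀ hl)⟩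
    · exact ⟨_, hcol r' h1' (by omega), _, .inl (hrow r' (M - 2) h1' (by omega) hl'),
        .inr (hadj₁ r' h1' (by omega))⟩
    · exact ⟨_, hrow (M - 1) (M - 2) h₀ hl hl', _, hcol (M - 1) h₀ hl, .inr (hadj₁ _ h₀ hl).symm⟩
    · exact ⟨_, hrow (M - 1) 0 h₀ hl hpow, _, hrow (M - 1) 0 h₀ hl hpow, .inl rfl⟩
    · exact ⟨_, hrow (M - 1) c' h₀ hl h3', _,
        .inr (hcr (M - 2) c' (by omega) (by omega) (by omega)),
        .inr (hadj₂ c' (by omega) (by omega))⟩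
    · exact ⟨_, .inl (hrow r (M - 2) h1 (by omega) hl'), _, hcol r h1 (by omega),
        .inr (hadj₁ r h1 (by omega)).symm⟩
    · exact ⟨_, .inr (hcr (M - 2) c (by omega) (by omega) (by omega)), _, hrow (M - 1) c h₀ hl h3,
        .inr (hadj₂ c (by omega) (by omega)).symm⟩
    · exact ⟨_, .inl (hrow r c' h1 (by omega) h3'), _, .inr (hcr r c' h1 (by omega) (by omega)),
        .inl rfl⟩)
  have hcol := ht _ (.inl rfl)
  have hrow := ht _ (.inr (.inl rfl))
  obtain ⟨a, ⟨ha1, ha2⟩, ha⟩ := hcol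
  obtain ⟨b, ⟨hb1, hb2⟩, hb⟩ := hrow
  have hab : a ≠ b := by rintro rfl; omega
  set S := d.bag t
  set S' := (S.erase a).erase b
  refine ⟨t, ?_⟩
  change M - 1 + 1 ≤ S.card
  have hcard : S'.card + 2 = S.card := by
    have h1 : (S.erase a).card + 1 = S.card := Finset.card_erase_add_one ha
    have h2 : S'.card + 1 = (S.erase a).card :=
      Finset.card_erase_add_one (Finset.mem_erase.2 ⟨hab.symm, hb⟩)
    omega
  by_contra! hlt
  have hmiss : ∀ (f : GridVertex k → ℕ) (T : Finset ℕ), T.card = M - 2 ∨ T.card = M - 1 →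
      ∃ i ∈ T, ∀ x ∈ S', f x ≠ i := by
    intro f T hT
    obtain ⟨i, hi, hi'⟩ := Finset.exists_mem_notMem_of_card_lt_card (s := S'.image f) (t := T)
      (Finset.card_image_le.trans_lt (by omega))
    exact ⟨i, hi, fun x hx h => hi' (Finset.mem_image.2 ⟨x, hx, h⟩)⟩
  obtain ⟨r, hr, hr'⟩ := hmiss (fun x => x.1.1) (Finset.Ico 1 (M - 1)) (by simp; omega)
  obtain ⟨c, hc, hc'⟩ := hmiss (fun x => x.1.2) (Finset.range (M - 1)) (by simp)
  rw [Finset.mem_Ico] at hr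
  rw [Finset.mem_range] at hc
  obtain ⟨x, hx, hxS⟩ := ht _ (.inr (.inr ⟨r, c, by omega, by omega, by omega, rfl⟩))
  have hx' : x ∈ S' := by
    refine Finset.mem_erase.2 ⟨?_, Finset.mem_erase.2 ⟨?_, hxS⟩⟩
    · rintro rfl
      rcases hx with ⟨h1, h2⟩ | ⟨h1, h2⟩ <;> omega
    · rintro rfl
      rcases hx with ⟨h1, h2⟩ | ⟨h1, h2⟩ <;> omega
  rcases hx with ⟨h1, h2⟩ | ⟨h1, h2⟩
  · exact hr' x hx' h1
  · exact hc' x hx' h1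

namespace SimpleGraph.Walk.IsPath

variable {α : Type*} {H : SimpleGraph α} {x y : α} {w : H.Walk x y}

theorem eq_of_mem_edges_start (hw : w.IsPath) {a b : α} (ha : s(x, a) ∈ w.edges)
    (hb : s(x, b) ∈ w.edges) : a = b := by
  cases w with
  | nil => simp at ha
  | @cons _ v _ h p =>
    rw [SimpleGraph.Walk.cons_isPath_iff] at hw
    have key : ∀ {a}, s(x, a) ∈ (SimpleGraph.Walk.cons h p).edges → a = v := by
      intro a ha
      rw [SimpleGraph.Walk.edges_cons, List.mem_cons] at ha
      rcases ha with ha | ha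
      · exact Sym2.congr_right.1 ha
      · exact absurd (p.fst_mem_support_of_mem_edges ha) hw.2
    rw [key ha, key hb]

theorem eq_of_mem_edges (hw : w.IsPath) {z a b c : α} (ha : s(z, a) ∈ w.edges)
    (hb : s(z, b) ∈ w.edges) (hc : s(z, c) ∈ w.edges) : a = b ∨ a = c ∨ b = c := by
  induction w with
  | nil => simp at ha
  | @cons u v t h p ih =>
    by_cases hz : z = u
    · subst hz
      exact .inl (hw.eq_of_mem_edges_start ha hb)
    rw [SimpleGraph.Walk.cons_isPath_iff] at hw
    have key : ∀ {a}, s(z, a) ∈ (SimpleGraph.Walk.cons h p).edges →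
        (z = v ∧ a = u) ∨ s(z, a) ∈ p.edges := by
      intro a ha
      rw [SimpleGraph.Walk.edges_cons, List.mem_cons] at ha
      rcases ha with ha | ha
      · rw [Sym2.eq_iff] at ha
        rcases ha with ⟨h1, -⟩ | ⟨h1, h2⟩
        · exact absurd h1 hz
        · exact .inl ⟨h1, h2⟩
      · exact .inr ha
    rcases key ha with ⟨hv, ha'⟩ | ha' <;> rcases key hb with ⟨hv', hb'⟩ | hb' <;>
      rcases key hc with ⟨hv'', hc'⟩ | hc'
    · exact .inl (ha'.trans hb'.symm)
    · exact .inl (ha'.trans hb'.symm)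
    · exact .inr (.inl (ha'.trans hc'.symm))
    · subst hv; exact .inr (.inr (hw.1.eq_of_mem_edges_start hb' hc'))
    · exact .inr (.inr (hb'.trans hc'.symm))
    · subst hv'; exact .inr (.inl (hw.1.eq_of_mem_edges_start ha' hc'))
    · subst hv''; exact .inl (hw.1.eq_of_mem_edges_start ha' hb')
    · exact ih hw.1 ha' hb' hc'

theorem exists_two_edges (hw : w.IsPath) {z : α} (hz : z ∈ w.support) (hx : z ≠ x) (hy : z ≠ y) :
    ∃ a b, a ≠ b ∧ s(z, a) ∈ w.edges ∧ s(z, b) ∈ w.edges := by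
  induction w with
  | nil => simp at hz; exact absurd hz hx
  | @cons u v t h p ih =>
    rw [SimpleGraph.Walk.support_cons, List.mem_cons] at hz
    have hz := hz.resolve_left hx
    rw [SimpleGraph.Walk.cons_isPath_iff] at hw
    by_cases hv : z = v
    · subst hv
      cases p with
      | nil => exact absurd rfl hy
      | @cons _ v' _ h' p' =>
        refine ⟨u, v', ?_, by simp [Sym2.eq_swap], by simp⟩
        rintro rfl
        exact hw.2 (by simp)
    · obtain ⟨a, b, hab, ha, hb⟩ := ih hw.1 hz hv hy
      exact ⟨a, b, hab, by simp [ha], by simp [hb]⟩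

end SimpleGraph.Walk.IsPath

namespace IsPathComponent

variable {α : Type*} {H : SimpleGraph α} {c : H.ConnectedComponent} {x y : α}

theorem symm (h : IsPathComponent H c x y) : IsPathComponent H c y x := by
  obtain ⟨w, h1, h2, h3⟩ := h
  exact ⟨w.reverse, h1.reverse, by simpa using h2, by simpa using h3⟩

theorem start_mem (h : IsPathComponent H c x y) : x ∈ c.supp := by
  obtain ⟨w, -, h2, -⟩ := h
  exact (h2 x).1 w.start_mem_support

theorem eq_of_adj_start (h : IsPathComponent H c x y) {a b : α} (ha : H.Adj x a)
    (hb : H.Adj x b) : a = b := by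
  have hx := h.start_mem
  obtain ⟨w, h1, h2, h3⟩ := h
  exact h1.eq_of_mem_edges_start (h3 _ _ hx ha) (h3 _ _ hx hb)

theorem eq_of_adj (h : IsPathComponent H c x y) {z a b d : α} (hz : z ∈ c.supp) (ha : H.Adj z a)
    (hb : H.Adj z b) (hd : H.Adj z d) : a = b ∨ a = d ∨ b = d := by
  obtain ⟨w, h1, h2, h3⟩ := h
  exact h1.eq_of_mem_edges (h3 _ _ hz ha) (h3 _ _ hz hb) (h3 _ _ hz hd)

theorem exists_two_adj (h : IsPathComponent H c x y) {z : α} (hz : z ∈ c.supp) (hx : z ≠ x)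
    (hy : z ≠ y) : ∃ a b, a ≠ b ∧ H.Adj z a ∧ H.Adj z b := by
  obtain ⟨w, h1, h2, h3⟩ := h
  obtain ⟨a, b, hab, ha, hb⟩ := h1.exists_two_edges ((h2 z).2 hz) hx hy
  exact ⟨a, b, hab, w.adj_of_mem_edges ha, w.adj_of_mem_edges hb⟩

theorem start_eq_or_eq (h : IsPathComponent H c x y) {x' y' : α} (h' : IsPathComponent H c x' y') :
    x' = x ∨ x' = y := by
  by_contra! hne
  obtain ⟨a, b, hab, ha, hb⟩ := h.exists_two_adj h'.start_mem hne.1 hne.2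
  exact hab (h'.eq_of_adj_start ha hb)

/-- In a graph of maximum degree two, a path between two vertices of degree one is a component. -/
theorem of_degree (hxy : x ≠ y) (hreach : H.Reachable x y)
    (hdeg : ∀ z a b c, H.Adj z a → H.Adj z b → H.Adj z c → a = b ∨ a = c ∨ b = c)
    (hx : ∀ a b, H.Adj x a → H.Adj x b → a = b) (hy : ∀ a b, H.Adj y a → H.Adj y b → a = b) :
    IsPathComponent H (H.connectedComponentMk x) x y := by
  obtain ⟨w, hw⟩ := hreach.exists_isPath
  have hstart : ∀ {x y : α} (w : H.Walk x y), x ≠ y → ∃ a, s(x, a) ∈ w.edges := by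
    intro x y w hxy
    cases w with
    | nil => exact absurd rfl hxy
    | cons h p => exact ⟨_, by rw [SimpleGraph.Walk.edges_cons]; exact List.mem_cons_self⟩
  have hedge : ∀ u v, u ∈ w.support → H.Adj u v → s(u, v) ∈ w.edges := by
    intro u v hu huv
    by_cases hux : u = x
    · subst hux
      obtain ⟨a, ha⟩ := hstart w hxy
      rwa [hx v a huv (w.adj_of_mem_edges ha)]
    by_cases huy : u = y
    · subst huy
      obtain ⟨a, ha⟩ := hstart w.reverse hxy.symm
      rw [SimpleGraph.Walk.edges_reverse, List.mem_reverse] at ha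
      rwa [hy v a huv (w.adj_of_mem_edges ha)]
    obtain ⟨a, b, hab, ha, hb⟩ := hw.exists_two_edges hu hux huy
    rcases hdeg u a b v (w.adj_of_mem_edges ha) (w.adj_of_mem_edges hb) huv with h | rfl | rfl
    · exact absurd h hab
    · exact ha
    · exact hb
  have hsupp : ∀ v, v ∈ w.support ↔ v ∈ (H.connectedComponentMk x).supp := by
    intro v
    rw [SimpleGraph.ConnectedComponent.mem_supp_iff, SimpleGraph.ConnectedComponent.eq]
    constructor
    · intro hv
      classical exact ⟨(w.takeUntil v hv).reverse⟩
    · rintro ⟨p⟩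
      have key : ∀ {a b : α}, H.Walk a b → b ∈ w.support → a ∈ w.support := by
        intro a b p hb
        induction p with
        | nil => exact hb
        | cons h p ih => exact w.snd_mem_support_of_mem_edges (hedge _ _ (ih hb) h.symm)
      exact key p w.start_mem_support
  exact ⟨w, hw, hsupp, fun u v hu huv => hedge u v ((hsupp u).2 hu) huv⟩

end IsPathComponent

/-- A linkage containing a spanning linkage with the same pattern and without trivial components
is equal to it. -/
theorem IsLinkage.eq_of_le {V : Type*} {G : SimpleGraph V} {L L' : G.Subgraph}
    (hL : IsLinkage G L) (hL' : IsLinkage G L') (hpat : LinkagePattern G L' = LinkagePattern G L)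
    (hverts : L.verts = Set.univ) (hle : ∀ u v, L.Adj u v → L'.Adj u v)
    (hnbr : ∀ u, ∃ v, L.Adj u v) : L' = L := by
  have hback : ∀ u v, L'.Adj u v → L.Adj u v := by
    intro u v huv
    have huL : u ∈ L.verts := hverts ▸ Set.mem_univ u
    have huL' : u ∈ L'.verts := L'.edge_vert huv
    obtain ⟨x, y, hc⟩ := hL (L.coe.connectedComponentMk ⟨u, huL⟩)
    have hstart : ∀ x y, IsPathComponent L.coe (L.coe.connectedComponentMk ⟨u, huL⟩) x y →
        (x : V) = u → L.Adj u v := by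
      intro x y hc hx
      obtain ⟨b, hb⟩ := hnbr u
      have hmem : s((x : V), (y : V)) ∈ LinkagePattern G L' := hpat ▸ ⟨x, y, _, hc, rfl⟩
      have h1 : ∃ (x' y' : L'.verts) (c' : L'.coe.ConnectedComponent),
          IsPathComponent L'.coe c' x' y' ∧ (x' : V) = u := by
        obtain ⟨x', y', c', hc', he⟩ := hmem
        rw [Sym2.eq_iff] at he
        rcases he with ⟨h1, -⟩ | ⟨h1, -⟩
        · exact ⟨x', y', c', hc', h1.symm.trans hx⟩
        · exact ⟨y', x', c', hc'.symm, h1.symm.trans hx⟩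
      obtain ⟨x', y', c', hc', rfl⟩ := h1
      have hb' := hle _ _ hb
      have := hc'.eq_of_adj_start (a := ⟨v, L'.edge_vert huv.symm⟩)
        (b := ⟨b, L'.edge_vert hb'.symm⟩) huv hb'
      rw [Subtype.mk.injEq] at this
      rwa [this]
    by_cases hux : (x : V) = u
    · exact hstart x y hc hux
    by_cases huy : (y : V) = u
    · exact hstart y x hc.symm huy
    obtain ⟨a, b, hab, ha, hb⟩ := hc.exists_two_adj (z := ⟨u, huL⟩) rfl
      (fun h => hux (by rw [← h])) (fun h => huy (by rw [← h]))
    obtain ⟨x', y', hc'⟩ := hL' (L'.coe.connectedComponentMk ⟨u, huL'⟩)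
    have ha' := hle _ _ ha
    have hb' := hle _ _ hb
    have := hc'.eq_of_adj (z := ⟨u, huL'⟩) (a := ⟨a, L'.edge_vert ha'.symm⟩)
      (b := ⟨b, L'.edge_vert hb'.symm⟩) (d := ⟨v, L'.edge_vert huv.symm⟩) rfl ha' hb' huv
    simp only [Subtype.mk.injEq] at this
    rcases this with h | h | h
    · exact absurd (Subtype.ext h) hab
    · exact h ▸ ha
    · exact h ▸ hb
  refine SimpleGraph.Subgraph.ext ?_ ?_
  · rw [hverts, Set.eq_univ_iff_forall]
    intro u
    obtain ⟨v, hv⟩ := hnbr u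
    exact L'.edge_vert (hle _ _ hv)
  · ext u v
    exact ⟨hback u v, hle u v⟩

/-- Rows joined by an arc at one of the two ends of the grid. -/
def RowStep (k r r' : ℕ) : Prop :=
  (0 < r ∧ r < 2 ^ k ∧ 0 < r' ∧ r' < 2 ^ k) ∧ (LeftTurn r r' ∨ (r ≠ r' ∧ r + r' = 2 ^ k))

/-- Rows belonging to the same strand. -/
abbrev SameStrand (k : ℕ) : ℕ → ℕ → Prop := Relation.ReflTransGen (RowStep k)

theorem RowStep.symm {k r r' : ℕ} (h : RowStep k r r') : RowStep k r' r := by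
  obtain ⟨h1, h2⟩ := h
  exact ⟨by omega, h2.imp LeftTurn.symm fun h => by omega⟩

theorem RowStep.two_mul {k r r' : ℕ} (h : RowStep k r r') : RowStep (k + 1) (2 * r) (2 * r') := by
  obtain ⟨h1, ⟨hne, e, h2, h3, h4⟩ | h2⟩ := h
  · exact ⟨by rw [pow_succ]; omega, .inl ⟨by omega, e + 1, by rw [pow_succ]; omega,
      by rw [pow_succ]; omega, by rw [pow_succ]; omega⟩⟩
  · exact ⟨by rw [pow_succ]; omega, .inr (by rw [pow_succ]; omega)⟩

theorem RowStep.add_one_sub_one {k r r' : ℕ} (h : RowStep k r r') :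
    RowStep (k + 1) (2 * r + 1) (2 * r' - 1) := by
  obtain ⟨h1, h | h2⟩ := h
  · have := h.not_consecutive
    obtain ⟨hne, e, h2, h3, h4⟩ := h
    exact ⟨by rw [pow_succ]; omega, .inl ⟨by omega, e + 1, by rw [pow_succ]; omega,
      by rw [pow_succ]; omega, by rw [pow_succ]; omega⟩⟩
  · refine ⟨by rw [pow_succ]; omega, .inr ⟨?_, by rw [pow_succ]; omega⟩⟩
    cases k with
    | zero => rw [pow_zero] at h1; omega
    | succ k => rw [pow_succ] at h2; omega

namespace SameStrand

theorem symm {k r r' : ℕ} (h : SameStrand k r r') : SameStrand k r' r :=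
  have : Std.Symm (RowStep k) := ⟨fun _ _ => RowStep.symm⟩
  Std.Symm.symm _ _ h

theorem two_mul {k r r' : ℕ} (h : SameStrand k r r') : SameStrand (k + 1) (2 * r) (2 * r') :=
  h.lift (2 * ·) fun _ _ => RowStep.two_mul

theorem parallel {k r r' : ℕ} (h : SameStrand k r r') :
    (SameStrand (k + 1) (2 * r + 1) (2 * r' + 1) ∧ SameStrand (k + 1) (2 * r - 1) (2 * r' - 1)) ∨
    (SameStrand (k + 1) (2 * r + 1) (2 * r' - 1) ∧
      SameStrand (k + 1) (2 * r - 1) (2 * r' + 1)) := by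
  induction h with
  | refl => exact .inl ⟨.refl, .refl⟩
  | tail _ h ih =>
    have h1 := h.add_one_sub_one
    have h2 := h.symm.add_one_sub_one.symm
    rcases ih with ⟨g1, g2⟩ | ⟨g1, g2⟩
    · exact .inr ⟨g1.tail h1, g2.tail h2⟩
    · exact .inl ⟨g1.tail h2, g2.tail h1⟩

theorem of_odd {k r : ℕ} (hr : Odd r) (hrk : r < 2 ^ k) : SameStrand k r 1 := by
  induction k generalizing r with
  | zero => rw [pow_zero] at hrk; obtain ⟨m, rfl⟩ := hr; omega
  | succ k ih =>
    obtain ⟨m, rfl⟩ := hr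
    rcases Nat.eq_zero_or_pos k with rfl | hk
    · obtain rfl : m = 0 := by simp at hrk; omega
      exact .refl
    obtain ⟨j, rfl⟩ : ∃ j, k = j + 1 := ⟨k - 1, by omega⟩
    have h31 : SameStrand (j + 1 + 1) 3 1 := by
      rcases Nat.eq_zero_or_pos j with rfl | hj
      · exact .single ⟨by norm_num, .inr (by norm_num)⟩
      obtain ⟨i, rfl⟩ : ∃ i, j = i + 1 := ⟨j - 1, by omega⟩
      have hi := Nat.one_le_two_pow (n := i)
      have h75 : SameStrand (i + 1 + 1 + 1) 7 5 :=
        .single ⟨by simp only [pow_succ]; omega, .inl ⟨by norm_num, 2, by norm_num⟩⟩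
      rcases (ih (r := 3) (by decide) (by simp only [pow_succ]; omega)).parallel with
        ⟨h1, h2⟩ | ⟨h1, h2⟩
      · exact (h1.symm.trans h75).trans h2
      · exact (h2.symm.trans h75.symm).trans h1
    rcases Nat.even_or_odd m with hm | hm
    · rcases (ih (r := m + 1) hm.add_one (by
        obtain ⟨n, rfl⟩ := hm
        rw [pow_succ] at hrk ⊢
        rw [pow_succ] at hrk
        omega)).parallel with ⟨-, h⟩ | ⟨-, h⟩
      · exact h
      · exact h.trans h31
    · rcases (ih hm (by rw [pow_succ] at hrk; omega)).parallel with ⟨h, -⟩ | ⟨h, -⟩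
      · exact h.trans h31
      · exact h

theorem exists_two_pow {k r : ℕ} (h0 : 0 < r) (hr : r < 2 ^ k) :
    ∃ v < k, SameStrand k r (2 ^ v) := by
  induction k generalizing r with
  | zero => simp at hr; omega
  | succ k ih =>
    rcases Nat.even_or_odd' r with ⟨m, rfl | rfl⟩
    · obtain ⟨v, hv, h⟩ := ih (r := m) (by omega) (by rw [pow_succ] at hr; omega)
      exact ⟨v + 1, by omega, by simpa [pow_succ, mul_comm] using h.two_mul⟩
    · exact ⟨0, by omega, of_odd (odd_two_mul_add_one m) hr⟩

theorem three_mul_two_pow {k v : ℕ} (hv : v + 1 < k) : SameStrand k (3 * 2 ^ v) (2 ^ v) := by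
  induction v generalizing k with
  | zero =>
    refine of_odd (by decide) ?_
    have := Nat.pow_le_pow_right (n := 2) (by norm_num) hv
    simp only [zero_add, pow_succ] at this
    omega
  | succ v ih =>
    obtain ⟨j, rfl⟩ : ∃ j, k = j + 1 := ⟨k - 1, by omega⟩
    have h := (ih (k := j) (by omega)).two_mul
    rwa [show 2 * (3 * 2 ^ v) = 3 * 2 ^ (v + 1) by ring, show 2 * 2 ^ v = 2 ^ (v + 1) by ring] at h

end SameStrand

/-- The subgraph of the folded grid formed by its strands. -/
def strandSubgraph (k : ℕ) : (boundedGrid k).Subgraph where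
  verts := Set.univ
  Adj u v := StrandAdj k (2 ^ k) u.1 v.1
  adj_sub h := .inl h
  edge_vert _ := Set.mem_univ _
  symm := ⟨fun _ _ => StrandAdj.symm⟩

theorem StrandAdj.halfEdge {k M : ℕ} {x y : ℕ × ℕ} (h : StrandAdj k M x y) :
    HalfEdge k M x y x.2 ∨ HalfEdge k M x y (x.2 + 1) := by
  rcases h with ⟨h1, h2 | h2⟩ | ⟨h1, h2, h3⟩ | ⟨h1, h2, h3, h4⟩
  · exact .inr (.inl ⟨h1, .inl h2, by omega⟩)
  · exact .inl (.inl ⟨h1, .inr h2, by omega⟩)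
  · exact .inl (.inr (.inl ⟨h1, h1, h2, h3⟩))
  · exact .inr (.inr (.inr ⟨h1, h1, h2, h3, h4⟩))

theorem HalfEdge.right_unique {k M : ℕ} (hM : 2 ≤ M) {x y y' : ℕ × ℕ} {c : ℕ}
    (h : HalfEdge k M x y c) (h' : HalfEdge k M x y' c)
    (hx : x.2 < M) (hy : y.2 < M) (hy' : y'.2 < M) : y' = y :=
  Sym2.congr_right.1 (h.unique hM h' rfl hx hy hx hy')

theorem StrandAdj.eq_of_three {k M : ℕ} (hM : 2 ≤ M) {x a b c : ℕ × ℕ} (ha : StrandAdj k M x a)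
    (hb : StrandAdj k M x b) (hc : StrandAdj k M x c) (hx : x.2 < M) (ham : a.2 < M)
    (hbm : b.2 < M) (hcm : c.2 < M) : a = b ∨ a = c ∨ b = c := by
  rcases ha.halfEdge with ha | ha <;> rcases hb.halfEdge with hb | hb <;>
    rcases hc.halfEdge with hc | hc
  · exact .inl (hb.right_unique hM ha hx hbm ham)
  · exact .inl (hb.right_unique hM ha hx hbm ham)
  · exact .inr (.inl (hc.right_unique hM ha hx hcm ham))
  · exact .inr (.inr (hc.right_unique hM hb hx hcm hbm))
  · exact .inr (.inr (hc.right_unique hM hb hx hcm hbm))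
  · exact .inr (.inl (hc.right_unique hM ha hx hcm ham))
  · exact .inl (hb.right_unique hM ha hx hbm ham)
  · exact .inl (hb.right_unique hM ha hx hbm ham)

theorem not_leftTurn_two_pow (v r : ℕ) : ¬ LeftTurn (2 ^ v) r := by
  rintro ⟨hne, e, h1, h2, h3⟩
  rcases two_pow_trichotomy v e with rfl | h | h <;> omega

theorem not_leftTurn_three_mul_two_pow (v r : ℕ) : ¬ LeftTurn (3 * 2 ^ v) r := by
  rintro ⟨hne, e, h1, h2, h3⟩
  rcases two_pow_trichotomy (v + 1) e with rfl | h | h <;> rw [pow_succ] at * <;> omega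

theorem StrandAdj.eq_of_source {k v : ℕ} (hk : 1 ≤ k) {a : ℕ × ℕ}
    (ha : StrandAdj k (2 ^ k) (source v) a) : a = (2 ^ v, 1) := by
  have hM : 2 ≤ 2 ^ k := by simpa using Nat.pow_le_pow_right (n := 2) (by norm_num) hk
  rcases ha with ⟨h1, h2⟩ | ⟨-, -, h⟩ | ⟨h, -⟩
  · simp only [source] at h1 h2
    exact Prod.ext h1.symm (by simp; omega)
  · exact absurd h (not_leftTurn_two_pow _ _)
  · simp only [source] at h; omega

theorem StrandAdj.eq_of_target {k v : ℕ} (hk : 1 ≤ k) {a b : ℕ × ℕ} (ham : a.2 < 2 ^ k)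
    (hbm : b.2 < 2 ^ k) (ha : StrandAdj k (2 ^ k) (target k (2 ^ k) v) a)
    (hb : StrandAdj k (2 ^ k) (target k (2 ^ k) v) b) : a = b := by
  have hM : 2 ≤ 2 ^ k := by simpa using Nat.pow_le_pow_right (n := 2) (by norm_num) hk
  by_cases hv : v + 1 = k
  · subst hv
    have key : ∀ {a : ℕ × ℕ}, a.2 < 2 ^ (v + 1) →
        StrandAdj (v + 1) (2 ^ (v + 1)) (target (v + 1) (2 ^ (v + 1)) v) a →
        a = (2 ^ v, 2 ^ (v + 1) - 2) := by
      intro a ham ha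
      rw [target, if_pos rfl] at ha
      rcases ha with ⟨h1, h2⟩ | ⟨h, -⟩ | ⟨-, -, h, h'⟩
      · exact Prod.ext h1.symm (by simp only at h2 ⊢; omega)
      · simp only at h; omega
      · simp only [pow_succ] at h h'; omega
    rw [key ham ha, key hbm hb]
  · have key : ∀ {a : ℕ × ℕ}, StrandAdj k (2 ^ k) (target k (2 ^ k) v) a → a = (3 * 2 ^ v, 1) := by
      intro a ha
      rw [target, if_neg hv] at ha
      rcases ha with ⟨h1, h2⟩ | ⟨-, -, h⟩ | ⟨h, -⟩
      · exact Prod.ext h1.symm (by simp only at h2 ⊢; omega)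
      · exact absurd h (not_leftTurn_three_mul_two_pow _ _)
      · simp only at h; omega
    rw [key ha, key hb]

theorem source_mem {k v : ℕ} (hv : v < k) :
    0 < (source v).1 ∧ (source v).1 < 2 ^ k ∧ (source v).2 < 2 ^ k :=
  ⟨by simp [source], Nat.pow_lt_pow_right (by norm_num) hv, by simp [source]⟩

theorem target_mem {k v : ℕ} (hv : v < k) : 0 < (target k (2 ^ k) v).1 ∧
    (target k (2 ^ k) v).1 < 2 ^ k ∧ (target k (2 ^ k) v).2 < 2 ^ k := by
  have h := Nat.pow_lt_pow_right (a := 2) (by norm_num) hv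
  rw [target]
  split_ifs with hvk
  · exact ⟨by simp, h, by simp⟩
  · have := Nat.pow_le_pow_right (n := 2) (by norm_num) (by omega : v + 2 ≤ k)
    rw [pow_add] at this
    refine ⟨by simp, ?_, by simp⟩
    simp only
    omega

/-- A vertex of the grid as a vertex of the strand subgraph. -/
abbrev strandVertex {k : ℕ} (p : ℕ × ℕ) (hp : 0 < p.1 ∧ p.1 < 2 ^ k ∧ p.2 < 2 ^ k) :
    (strandSubgraph k).verts := ⟨⟨p, hp⟩, Set.mem_univ _⟩

theorem strandSubgraph_reachable_row {k r c : ℕ} (h0 : 0 < r) (hr : r < 2 ^ k) (hc : c < 2 ^ k) :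
    (strandSubgraph k).coe.Reachable (strandVertex (r, c) ⟨h0, hr, hc⟩)
      (strandVertex (r, 0) ⟨h0, hr, Nat.two_pow_pos k⟩) := by
  induction c with
  | zero => exact .refl _
  | succ c ih =>
    refine .trans (SimpleGraph.Adj.reachable ?_) (ih (by omega))
    exact .inl ⟨rfl, .inr rfl⟩

theorem strandSubgraph_reachable_of_rowStep {k r r' : ℕ} (h : RowStep k r r') :
    (strandSubgraph k).coe.Reachable
      (strandVertex (r, 0) ⟨h.1.1, h.1.2.1, Nat.two_pow_pos k⟩)
      (strandVertex (r', 0) ⟨h.1.2.2.1, h.1.2.2.2, Nat.two_pow_pos k⟩) := by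
  obtain ⟨⟨h1, h2, h3, h4⟩, h | h⟩ := h
  · exact SimpleGraph.Adj.reachable (.inr (.inl ⟨rfl, rfl, h⟩))
  · have hk := Nat.two_pow_pos k
    have hlt : 2 ^ k - 1 < 2 ^ k := by omega
    refine (strandSubgraph_reachable_row h1 h2 hlt).symm.trans
      (.trans (SimpleGraph.Adj.reachable ?_) (strandSubgraph_reachable_row h3 h4 hlt))
    exact .inr (.inr ⟨Nat.sub_add_cancel hk, Nat.sub_add_cancel hk, h⟩)

theorem SameStrand.reachable {k r r' : ℕ} (h : SameStrand k r r') (h0 : 0 < r) (hr : r < 2 ^ k)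
    (h0' : 0 < r') (hr' : r' < 2 ^ k) :
    (strandSubgraph k).coe.Reachable (strandVertex (r, 0) ⟨h0, hr, Nat.two_pow_pos k⟩)
      (strandVertex (r', 0) ⟨h0', hr', Nat.two_pow_pos k⟩) := by
  induction h with
  | refl => exact .refl _
  | tail _ h ih => exact (ih h.1.1 h.1.2.1).trans (strandSubgraph_reachable_of_rowStep h)

theorem exists_source_reachable {k : ℕ} (x : (strandSubgraph k).verts) :
    ∃ v, ∃ hv : v < k,
      (strandSubgraph k).coe.Reachable (strandVertex (source v) (source_mem hv)) x := by
  obtain ⟨⟨⟨r, c⟩, h0, hr, hc⟩, -⟩ := x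
  obtain ⟨v, hv, h⟩ := SameStrand.exists_two_pow h0 hr
  exact ⟨v, hv, ((strandSubgraph_reachable_row h0 hr hc).trans
    (h.reachable h0 hr (source_mem hv).1 (source_mem hv).2.1)).symm⟩

theorem source_reachable_target {k v : ℕ} (hv : v < k) :
    (strandSubgraph k).coe.Reachable (strandVertex (source v) (source_mem hv))
      (strandVertex (target k (2 ^ k) v) (target_mem hv)) := by
  have hs := source_mem hv
  have ht := target_mem hv
  by_cases hvk : v + 1 = k
  · simp only [target, if_pos hvk]
    exact (strandSubgraph_reachable_row hs.1 hs.2.1 (Nat.sub_lt (Nat.two_pow_pos k) one_pos)).symm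
  · simp only [target, if_neg hvk] at ht ⊢
    exact ((SameStrand.three_mul_two_pow (by omega)).reachable ht.1 ht.2.1 hs.1 hs.2.1).symm

theorem source_ne_target {k v w : ℕ} (hk : 1 ≤ k) : source w ≠ target k (2 ^ k) v := by
  intro h
  rw [source, target] at h
  have hM : 2 ≤ 2 ^ k := by simpa using Nat.pow_le_pow_right (n := 2) (by norm_num) hk
  split_ifs at h with hv
  · have := congrArg Prod.snd h
    simp only at this
    omega
  · have := congrArg Prod.fst h
    simp only at this
    have hsucc := pow_succ 2 v
    have hpos := Nat.two_pow_pos v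
    rcases two_pow_trichotomy w (v + 1) with rfl | h' | h' <;> omega

theorem source_injective : Function.Injective source := fun _ _ h =>
  Nat.pow_right_injective le_rfl (congrArg Prod.fst h)

theorem isPathComponent_strand {k v : ℕ} (hv : v < k) :
    IsPathComponent (strandSubgraph k).coe
      ((strandSubgraph k).coe.connectedComponentMk (strandVertex (source v) (source_mem hv)))
      (strandVertex (source v) (source_mem hv))
      (strandVertex (target k (2 ^ k) v) (target_mem hv)) := by
  have hk : 1 ≤ k := by omega
  have hM : 2 ≤ 2 ^ k := by simpa using Nat.pow_le_pow_right (n := 2) (by norm_num) hk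
  refine IsPathComponent.of_degree ?_ (source_reachable_target hv) ?_ ?_ ?_
  · exact fun h => source_ne_target hk (congrArg (fun x => x.1.1) h)
  · intro z a b c ha hb hc
    simpa only [Subtype.ext_iff] using StrandAdj.eq_of_three hM ha hb hc z.1.2.2.2 a.1.2.2.2
      b.1.2.2.2 c.1.2.2.2
  · exact fun a b ha hb => Subtype.ext (Subtype.ext
      ((StrandAdj.eq_of_source hk ha).trans (StrandAdj.eq_of_source hk hb).symm))
  · exact fun a b ha hb => Subtype.ext (Subtype.ext
      (StrandAdj.eq_of_target hk a.1.2.2.2 b.1.2.2.2 ha hb))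

theorem isLinkage_strandSubgraph (k : ℕ) : IsLinkage (boundedGrid k) (strandSubgraph k) := by
  intro c
  induction c using SimpleGraph.ConnectedComponent.ind with
  | h x =>
    obtain ⟨v, hv, h⟩ := exists_source_reachable x
    rw [← SimpleGraph.ConnectedComponent.eq.2 h]
    exact ⟨_, _, isPathComponent_strand hv⟩

theorem card_connectedComponent_strandSubgraph (k : ℕ) :
    Nat.card (strandSubgraph k).coe.ConnectedComponent = k := by
  refine (Nat.card_eq_of_bijective (fun v : Fin k => (strandSubgraph k).coe.connectedComponentMk
    (strandVertex (source v) (source_mem v.2))) ⟨?_, ?_⟩).symm.trans (Nat.card_fin k)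
  · intro v w h
    have hw := isPathComponent_strand w.2
    beta_reduce at h
    rw [← h] at hw
    rcases (isPathComponent_strand v.2).start_eq_or_eq hw with h | h
    · exact Fin.ext (source_injective (congrArg (fun x => x.1.1) h)).symm
    · exact absurd (congrArg (fun x => x.1.1) h) (source_ne_target v.pos)
  · intro c
    induction c using SimpleGraph.ConnectedComponent.ind with
    | h x =>
      obtain ⟨v, hv, h⟩ := exists_source_reachable x
      exact ⟨⟨v, hv⟩, SimpleGraph.ConnectedComponent.eq.2 h⟩

theorem strandSubgraph_exists_adj {k : ℕ} (hk : 1 ≤ k) (u : GridVertex k) :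
    ∃ v, (strandSubgraph k).Adj u v := by
  have hM : 2 ≤ 2 ^ k := by simpa using Nat.pow_le_pow_right (n := 2) (by norm_num) hk
  obtain ⟨⟨r, c⟩, h0, hr, hc⟩ := u
  simp only at h0 hr hc
  rcases Nat.eq_zero_or_pos c with rfl | hc0
  · exact ⟨⟨(r, 1), h0, hr, by simp; omega⟩, .inl ⟨rfl, .inl rfl⟩⟩
  · exact ⟨⟨(r, c - 1), h0, hr, by simp; omega⟩, .inl ⟨rfl, .inr (Nat.sub_add_cancel hc0)⟩⟩

/-- The projection of a subgraph of the grid to the unbounded folded grid. -/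
def toFoldedGrid {k : ℕ} (L : (boundedGrid k).Subgraph) : L.coe →g foldedGrid k (2 ^ k) where
  toFun x := x.1.1
  map_rel' h := L.adj_sub h

theorem toFoldedGrid_injective {k : ℕ} (L : (boundedGrid k).Subgraph) :
    Function.Injective (toFoldedGrid L) :=
  fun _ _ h => Subtype.ext (Subtype.ext h)

/-- A linkage with the pattern of the strands contains a path between the ends of each strand. -/
theorem exists_isPathComponent_of_pattern_eq {k : ℕ} {L : (boundedGrid k).Subgraph}
    (hpat : LinkagePattern (boundedGrid k) L = LinkagePattern (boundedGrid k) (strandSubgraph k))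
    {v : ℕ} (hv : v < k) : ∃ x y c, IsPathComponent L.coe c x y ∧
      toFoldedGrid L x = source v ∧ toFoldedGrid L y = target k (2 ^ k) v := by
  have hmem : s((⟨source v, source_mem hv⟩ : GridVertex k),
      (⟨target k (2 ^ k) v, target_mem hv⟩ : GridVertex k)) ∈ LinkagePattern (boundedGrid k) L :=
    hpat ▸ ⟨_, _, _, isPathComponent_strand hv, rfl⟩
  obtain ⟨x, y, c, hc, hxy⟩ := hmem
  rcases Sym2.eq_iff.1 hxy with ⟨h1, h2⟩ | ⟨h1, h2⟩
  · exact ⟨x, y, c, hc, congrArg Subtype.val h1.symm, congrArg Subtype.val h2.symm⟩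
  · exact ⟨y, x, c, hc.symm, congrArg Subtype.val h1.symm, congrArg Subtype.val h2.symm⟩

theorem strandSubgraph_adj_imp_adj {k : ℕ} (hk : 1 ≤ k) {L : (boundedGrid k).Subgraph}
    (hpat : LinkagePattern (boundedGrid k) L = LinkagePattern (boundedGrid k) (strandSubgraph k))
    {u v : GridVertex k} (h : (strandSubgraph k).Adj u v) : L.Adj u v := by
  have hM : 2 ≤ 2 ^ k := by simpa using Nat.pow_le_pow_right (n := 2) (by norm_num) hk
  choose x y c hc hx hy using fun v (hv : v < k) => exists_isPathComponent_of_pattern_eq hpat hv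
  have hinj : ∀ v w hv hw, c v hv = c w hw → v = w := by
    intro v w hv hw h
    have hcw := hc w hw
    rw [← h] at hcw
    rcases (hc v hv).start_eq_or_eq hcw with h | h
    · exact source_injective (by rw [← hx v hv, ← hx w hw, h])
    · exact absurd (by rw [← hx w hw, h, hy v hv]) (source_ne_target (v := v) (w := w) hk)
  choose w _ hsupp _ using hc
  have hsupp_map : ∀ v hv z,
      z ∈ (((w v hv).map (toFoldedGrid L)).copy (hx v hv) (hy v hv)).support →
      ∃ z' ∈ (c v hv).supp, toFoldedGrid L z' = z := by
    intro v hv z hz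
    rw [SimpleGraph.Walk.support_copy, SimpleGraph.Walk.support_map, List.mem_map] at hz
    obtain ⟨z', hz', rfl⟩ := hz
    exact ⟨z', (hsupp v hv z').1 hz', rfl⟩
  have hedges : ∀ v hv e, e ∈ (((w v hv).map (toFoldedGrid L)).copy (hx v hv) (hy v hv)).edges →
      ∃ e' ∈ (w v hv).edges, e'.map (toFoldedGrid L) = e := by
    intro v hv e he
    rwa [SimpleGraph.Walk.edges_copy, SimpleGraph.Walk.edges_map, List.mem_map] at he
  let P : Routing k (2 ^ k) :=
    { path := fun v hv => ((w v hv).map (toFoldedGrid L)).copy (hx v hv) (hy v hv)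
      disj := by
        intro v v' hv hv' z hz hz'
        obtain ⟨a, ha, hza⟩ := hsupp_map v hv z hz
        obtain ⟨b, hb, hzb⟩ := hsupp_map v' hv' z hz'
        obtain rfl : a = b := toFoldedGrid_injective L (hza.trans hzb.symm)
        exact hinj _ _ _ _ (ha.symm.trans hb)
      range := by
        intro v hv z hz
        obtain ⟨a, -, rfl⟩ := hsupp_map v hv z hz
        exact a.1.2 }
  obtain ⟨v', hv', he⟩ := P.mem_edges_of_strandAdj hk hM h u.2 v.2
  obtain ⟨e, he, heq⟩ := hedges v' hv' _ he
  induction e with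
  | h a b =>
    have hab : L.Adj a.1 b.1 := (w v' hv').adj_of_mem_edges he
    rcases Sym2.eq_iff.1 heq with ⟨h1, h2⟩ | ⟨h1, h2⟩
    · rwa [show u = a.1 from Subtype.ext h1.symm, show v = b.1 from Subtype.ext h2.symm]
    · rw [show u = b.1 from Subtype.ext h2.symm, show v = a.1 from Subtype.ext h1.symm]
      exact hab.symm

theorem isVitalLinkage_strandSubgraph {k : ℕ} (hk : 1 ≤ k) :
    IsVitalLinkage (boundedGrid k) (strandSubgraph k) :=
  ⟨isLinkage_strandSubgraph k, rfl, fun _ hL hpat => (isLinkage_strandSubgraph k).eq_of_le hL hpat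
    rfl (fun _ _ => strandSubgraph_adj_imp_adj hk hpat) (strandSubgraph_exists_adj hk)⟩

/-- If `h : ℕ → ℕ` is such that every finite simple graph having a vital linkage
with `k` components has path-width at most `h k`, then `h k ≥ 2 ^ k - 1` for every `k ≥ 1`. -/
theorem lower_bound_on_vital_linkage_pathwidth_function (h : ℕ → ℕ)
    (hh : ∀ (k : ℕ) (V : Type) [Fintype V] (G : SimpleGraph V) (L : G.Subgraph),
      IsVitalLinkage G L → Nat.card L.coe.ConnectedComponent = k →
      pathwidth G ≤ h k) :
    ∀ k : ℕ, 1 ≤ k → 2 ^ k - 1 ≤ h k := by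
  intro k hk
  have := Fintype.ofFinite (GridVertex k)
  exact (two_pow_sub_one_le_pathwidth hk).trans (hh k (GridVertex k) (boundedGrid k)
    (strandSubgraph k) (isVitalLinkage_strandSubgraph hk)
    (card_connectedComponent_strandSubgraph k))
end

section
/- For every k ≥ 1, the graph G_k contains a vital linkage with exactly k components whose pattern is {{s_1,t_1},…,{s_k,t_k}}. -/
open SimpleGraph

/-- Data of a graph together with its top row, bottom row and terminals `s`, `t`
(indexed by `ℕ`; index `i` stands for the terminal pair `(s_{i+1}, t_{i+1})`). -/
structure RowedGraph (p : ℕ) where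
  V : Type
  G : SimpleGraph V
  top : Fin p → V
  bot : Fin p → V
  s : ℕ → V
  t : ℕ → V

/-- The instance `G_{1,p}`: a path `x_1, …, x_p` on `p` vertices, with `s_1 = x_1`,
`t_1 = x_p`, and top and bottom row both equal to `x_1, …, x_p`. -/
def baseRG (p : ℕ) (hp : 0 < p) : RowedGraph p where
  V := Fin p
  G := SimpleGraph.fromRel fun i j => i.val + 1 = j.val
  top := id
  bot := id
  s := fun _ => ⟨0, hp⟩
  t := fun _ => ⟨p - 1, by omega⟩

/-- The step of the construction: `G_{k+1,p}` is obtained from `R = G_{k,2p}` (with bottom row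
`x_1, …, x_{2p}` and top row `z_1, …, z_{2p}`) by adding a new path `y_1, …, y_p` together with
the edges `{y_i, x_i}` and `{y_i, x_{2p-i+1}}`; the new terminal pair is `s_{k+1} = y_1`,
`t_{k+1} = y_p`; the new top row is `z_1, …, z_p` and the new bottom row is `z_{2p}, …, z_{p+1}`.
(Here `k` is the number of terminal pairs of `R`, and everything is 0-indexed.) -/
def stepRG (k : ℕ) {p : ℕ} (hp : 0 < p) (R : RowedGraph (2 * p)) : RowedGraph p where
  V := R.V ⊕ Fin p
  G := SimpleGraph.fromRel fun a b =>
    match a, b with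
    | Sum.inl u, Sum.inl v => R.G.Adj u v
    | Sum.inr i, Sum.inr j => i.val + 1 = j.val
    | Sum.inr i, Sum.inl v =>
        v = R.bot ⟨i.val, by have := i.isLt; omega⟩ ∨
        v = R.bot ⟨2 * p - 1 - i.val, by have := i.isLt; omega⟩
    | Sum.inl _, Sum.inr _ => False
  top := fun i => Sum.inl (R.top ⟨i.val, by have := i.isLt; omega⟩)
  bot := fun i => Sum.inl (R.top ⟨2 * p - 1 - i.val, by have := i.isLt; omega⟩)
  s := fun i => if i < k then Sum.inl (R.s i) else Sum.inr ⟨0, hp⟩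
  t := fun i => if i < k then Sum.inl (R.t i) else Sum.inr ⟨p - 1, by omega⟩

/-- `GP k p hp` is the instance `G_{k+1,p}` of the paper (so the paper's `G_{k,p}`, `k ≥ 1`,
is `GP (k-1) p hp`), together with its rows and terminals. -/
def GP : (k p : ℕ) → 0 < p → RowedGraph p
  | 0, p, hp => baseRG p hp
  | k + 1, p, hp => stepRG (k + 1) hp (GP k (2 * p) (by omega))

lemma two_pow_sub_one_pos {k : ℕ} (hk : 1 ≤ k) : 0 < 2 ^ k - 1 := by
  have h2 : 2 ^ 1 ≤ 2 ^ k := Nat.pow_le_pow_right (by norm_num) hk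
  simp only [pow_one] at h2
  omega

/-- Adjacency of the points `(x, y)` and `(x', y')` in the planar drawing of `G_{k+1,p}`: `p` columns
`0, …, p - 1` and rows `1, …, 2 ^ (k + 1) - 1`, nested arcs closing up the last column, and `k`
nests of arcs along the first column. -/
def GridEdge (k p x y x' y' : ℕ) : Prop :=
  (y = y' ∧ (x + 1 = x' ∨ x' + 1 = x)) ∨
  (x = x' ∧ (y + 1 = y' ∨ y' + 1 = y)) ∨
  (x = x' ∧ x + 1 = p ∧ y + y' = 2 ^ (k + 1)) ∨
  (x = 0 ∧ x' = 0 ∧ ∃ i < k, (2 ^ (i + 1) < y ∧ y < 2 ^ (i + 2)) ∧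
    (2 ^ (i + 1) < y' ∧ y' < 2 ^ (i + 2)) ∧ y + y' = 3 * 2 ^ (i + 1))

/-- Two coordinate systems on `G_{k+1,p}`: the position `(x, y)` in the planar drawing, and
the position `idx` on the path number `cls` of the canonical linkage. -/
structure GridCoords (k : ℕ) {p : ℕ} (R : RowedGraph p) where
  x : R.V → ℕ
  y : R.V → ℕ
  cls : R.V → ℕ
  idx : R.V → ℕ
  x_lt : ∀ u, x u < p
  y_pos : ∀ u, 0 < y u
  y_lt : ∀ u, y u < 2 ^ (k + 1)
  xy_inj : ∀ u v, x u = x v → y u = y v → u = v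
  xy_surj : ∀ a < p, ∀ b, 0 < b → b < 2 ^ (k + 1) → ∃ u, x u = a ∧ y u = b
  cls_le : ∀ u, cls u ≤ k
  idx_lt : ∀ u, idx u < 2 ^ (k - cls u) * p
  ci_inj : ∀ u v, cls u = cls v → idx u = idx v → u = v
  ci_surj : ∀ j ≤ k, ∀ a < 2 ^ (k - j) * p, ∃ u, cls u = j ∧ idx u = a
  y_cls : ∀ u, ∃ b, y u = 2 ^ cls u * (2 * b + 1)
  adj : ∀ u v, R.G.Adj u v → GridEdge k p (x u) (y u) (x v) (y v)
  adj_iff : ∀ u v, cls u = cls v → (R.G.Adj u v ↔ idx u + 1 = idx v ∨ idx v + 1 = idx u)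
  top_x : ∀ i, x (R.top i) = i
  top_y : ∀ i, y (R.top i) = 1
  bot_x : ∀ i, x (R.bot i) = i
  bot_y : ∀ i, y (R.bot i) = 2 ^ (k + 1) - 1
  s_x : ∀ i ≤ k, x (R.s i) = 0
  s_y : ∀ i ≤ k, y (R.s i) = 2 ^ i
  s_cls : ∀ i ≤ k, cls (R.s i) = i
  s_idx : ∀ i ≤ k, idx (R.s i) = 0
  t_x : ∀ i < k, x (R.t i) = 0
  t_y : ∀ i < k, y (R.t i) = 3 * 2 ^ i
  t_x_last : x (R.t k) = p - 1
  t_y_last : y (R.t k) = 2 ^ k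
  t_cls : ∀ i ≤ k, cls (R.t i) = i
  t_idx : ∀ i ≤ k, idx (R.t i) + 1 = 2 ^ (k - i) * p

/-- The coordinates on a single path. -/
def baseCoords (p : ℕ) (hp : 0 < p) : GridCoords 0 (baseRG p hp) where
  x := fun u : Fin p => u.val
  y := fun _ => 1
  cls := fun _ => 0
  idx := fun u : Fin p => u.val
  x_lt := fun u : Fin p => u.isLt
  y_pos := by simp
  y_lt := by simp
  xy_inj := fun (u v : Fin p) h _ => Fin.ext h
  xy_surj := fun a ha b hb hb' => ⟨(⟨a, ha⟩ : Fin p), rfl, by simp at hb'; omega⟩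
  cls_le := by simp
  idx_lt := fun u : Fin p => by simp
  ci_inj := fun (u v : Fin p) _ h => Fin.ext h
  ci_surj := fun j hj a ha => ⟨(⟨a, by simpa using ha⟩ : Fin p), by omega, rfl⟩
  y_cls := fun _ => ⟨0, by simp⟩
  adj := fun (u v : Fin p) h => by
    have h := ((fromRel_adj _ u v).1 h).2
    exact Or.inl ⟨rfl, h⟩
  adj_iff := fun (u v : Fin p) _ => by
    refine (fromRel_adj _ u v).trans ⟨fun h => h.2, fun h => ⟨?_, h⟩⟩
    rintro rfl
    omega
  top_x := fun _ => rfl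
  top_y := fun _ => rfl
  bot_x := fun _ => rfl
  bot_y := by simp
  s_x := fun _ _ => rfl
  s_y := fun i hi => by simp [Nat.le_zero.1 hi]
  s_cls := fun i hi => by omega
  s_idx := fun _ _ => rfl
  t_x := fun i hi => by omega
  t_y := fun i hi => by omega
  t_x_last := rfl
  t_y_last := by simp
  t_cls := fun i hi => by omega
  t_idx := fun i hi => by
    show p - 1 + 1 = _
    simp
    omega

section Step

variable {k p : ℕ} {hp : 0 < p} {R : RowedGraph (2 * p)}

lemma stepRG_adj_inl_inl {u v : R.V} :
    (stepRG k hp R).G.Adj (Sum.inl u) (Sum.inl v) ↔ R.G.Adj u v := by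
  refine (fromRel_adj _ _ _).trans ⟨fun h => h.2.elim id fun h => h.symm, fun h => ⟨?_, Or.inl h⟩⟩
  rintro h'
  exact h.ne (Sum.inl.inj h')

lemma stepRG_adj_inr_inr {i j : Fin p} :
    (stepRG k hp R).G.Adj (Sum.inr i) (Sum.inr j) ↔ i.val + 1 = j.val ∨ j.val + 1 = i.val := by
  refine (fromRel_adj _ _ _).trans ⟨fun h => h.2, fun h => ⟨?_, h⟩⟩
  rintro h'
  cases h'
  omega

lemma stepRG_adj_inr_inl {i : Fin p} {v : R.V} :
    (stepRG k hp R).G.Adj (Sum.inr i) (Sum.inl v) ↔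
      v = R.bot ⟨i.val, by omega⟩ ∨ v = R.bot ⟨2 * p - 1 - i.val, by omega⟩ := by
  refine (fromRel_adj _ _ _).trans ⟨fun h => h.2.elim id False.elim, fun h => ⟨?_, Or.inl h⟩⟩
  rintro h'
  cases h'

end Step

lemma GridEdge.symm {k p x y x' y' : ℕ} (h : GridEdge k p x y x' y') :
    GridEdge k p x' y' x y := by
  rcases h with h | h | h | ⟨h, h', i, hi, h1, h2, h3⟩
  · exact Or.inl ⟨h.1.symm, h.2.symm⟩
  · exact Or.inr (Or.inl ⟨h.1.symm, h.2.symm⟩)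
  · exact Or.inr (Or.inr (Or.inl (by omega)))
  · exact Or.inr (Or.inr (Or.inr ⟨h', h, i, hi, h2, h1, by omega⟩))

/-- Column of the image of `(x, y)` when the drawing with `2 * p` columns is folded. -/
def foldX (p x : ℕ) : ℕ := if x < p then x else 2 * p - 1 - x

/-- Row of the image of `(x, y)` when the drawing with `2 * p` columns is folded. -/
def foldY (k p x y : ℕ) : ℕ := if x < p then y else 2 ^ (k + 2) - y

lemma GridEdge.fold {k p x y x' y' : ℕ} (h : GridEdge k (2 * p) x y x' y')
    (hx : x < 2 * p) (hx' : x' < 2 * p) (hy : y < 2 ^ (k + 1)) (hy' : y' < 2 ^ (k + 1))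
    (hy0 : 0 < y) :
    GridEdge (k + 1) p (foldX p x) (foldY k p x y) (foldX p x') (foldY k p x' y') := by
  have e2 : 2 ^ (k + 2) = 2 * 2 ^ (k + 1) := by ring
  have e3 : 2 ^ (k + 1 + 1) = 2 * 2 ^ (k + 1) := by ring
  unfold foldX foldY
  rcases h with h | h | h | ⟨h, h', i, hi, h1, h2, h3⟩
  · by_cases hc : x < p ↔ x' < p
    · left
      split_ifs <;> omega
    · right; right; left
      split_ifs <;> omega
  · right; left
    split_ifs <;> omega
  · right; right; right
    refine ⟨by split_ifs <;> omega, by split_ifs <;> omega, k, by omega, ?_, ?_, ?_⟩ <;>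
    · split_ifs <;> omega
  · right; right; right
    refine ⟨by split_ifs <;> omega, by split_ifs <;> omega, i, by omega, ?_, ?_, ?_⟩ <;>
    · split_ifs <;> omega

/-- The coordinates on a folded graph. -/
def stepCoords {k p : ℕ} (hp : 0 < p) {R : RowedGraph (2 * p)} (C : GridCoords k R) :
    GridCoords (k + 1) (stepRG (k + 1) hp R) where
  x := Sum.elim (fun u => foldX p (C.x u)) (fun i : Fin p => i.val)
  y := Sum.elim (fun u => foldY k p (C.x u) (C.y u)) (fun _ => 2 ^ (k + 1))
  cls := Sum.elim C.cls (fun _ => k + 1)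
  idx := Sum.elim C.idx (fun i : Fin p => i.val)
  x_lt := by
    rintro (u | i)
    · have := C.x_lt u
      simp only [Sum.elim_inl, foldX]
      split_ifs <;> omega
    · exact i.isLt
  y_pos := by
    rintro (u | i)
    · have := C.y_pos u
      have := C.y_lt u
      have e2 : 2 ^ (k + 2) = 2 * 2 ^ (k + 1) := by ring
      simp only [Sum.elim_inl, foldY]
      split_ifs <;> omega
    · simp
  y_lt := by
    have e2 : 2 ^ (k + 2) = 2 * 2 ^ (k + 1) := by ring
    have e3 : 2 ^ (k + 1 + 1) = 2 * 2 ^ (k + 1) := by ring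
    rintro (u | i)
    · have := C.y_pos u
      have := C.y_lt u
      simp only [Sum.elim_inl, foldY]
      split_ifs <;> omega
    · have : 0 < 2 ^ (k + 1) := by positivity
      simp only [Sum.elim_inr]
      omega
  xy_inj := by
    have e2 : 2 ^ (k + 2) = 2 * 2 ^ (k + 1) := by ring
    rintro (u | i) (v | j) h h' <;>
      simp only [Sum.elim_inl, Sum.elim_inr, foldX, foldY] at h h'
    · have := C.y_lt u
      have := C.y_lt v
      have := C.x_lt u
      have := C.x_lt v
      rw [C.xy_inj u v (by split_ifs at h h' <;> omega) (by split_ifs at h h' <;> omega)]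
    · have := C.y_lt u
      split_ifs at h' <;> omega
    · have := C.y_lt v
      split_ifs at h' <;> omega
    · rw [Fin.ext h]
  xy_surj := by
    intro a ha b hb hb'
    have e2 : 2 ^ (k + 2) = 2 * 2 ^ (k + 1) := by ring
    have e3 : 2 ^ (k + 1 + 1) = 2 * 2 ^ (k + 1) := by ring
    rcases lt_trichotomy b (2 ^ (k + 1)) with h | h | h
    · obtain ⟨u, hu, hu'⟩ := C.xy_surj a (by omega) b hb h
      refine ⟨Sum.inl u, ?_, ?_⟩ <;> simp [foldX, foldY, hu, hu', ha]
    · exact ⟨Sum.inr ⟨a, ha⟩, rfl, h.symm⟩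
    · obtain ⟨u, hu, hu'⟩ := C.xy_surj (2 * p - 1 - a) (by omega) (2 ^ (k + 2) - b) (by omega)
        (by omega)
      refine ⟨Sum.inl u, ?_, ?_⟩ <;> simp only [Sum.elim_inl, foldX, foldY, hu, hu'] <;>
        split_ifs <;> omega
  cls_le := by
    rintro (u | i)
    · exact (C.cls_le u).trans (by omega)
    · exact le_rfl
  idx_lt := by
    rintro (u | i)
    · have h := C.idx_lt u
      have h' := C.cls_le u
      have e : k + 1 - C.cls u = (k - C.cls u) + 1 := by omega
      simp only [Sum.elim_inl]
      rw [e, pow_succ, mul_assoc]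
      exact h
    · simp
  ci_inj := by
    rintro (u | i) (v | j) h h' <;> simp only [Sum.elim_inl, Sum.elim_inr] at h h'
    · rw [C.ci_inj u v h h']
    · have := C.cls_le u
      omega
    · have := C.cls_le v
      omega
    · rw [Fin.ext h']
  ci_surj := by
    intro j hj a ha
    rcases Nat.lt_or_ge k j with h | h
    · obtain rfl : j = k + 1 := by omega
      exact ⟨Sum.inr ⟨a, by simpa using ha⟩, rfl, rfl⟩
    · have e : k + 1 - j = (k - j) + 1 := by omega
      rw [e, pow_succ, mul_assoc] at ha
      obtain ⟨u, hu, hu'⟩ := C.ci_surj j h a ha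
      exact ⟨Sum.inl u, hu, hu'⟩
  y_cls := by
    rintro (u | i)
    · obtain ⟨b, hb⟩ := C.y_cls u
      simp only [Sum.elim_inl, foldY]
      split_ifs
      · exact ⟨b, hb⟩
      · have h := C.y_lt u
        have h' := C.cls_le u
        have e : 2 ^ (k + 2) = 2 ^ C.cls u * (2 * 2 ^ (k + 1 - C.cls u)) := by
          rw [← pow_succ', ← pow_add]
          congr 1
          omega
        have e' : 2 ^ (k + 2) = 2 * 2 ^ (k + 1) := by ring
        have hlt : 2 * b + 1 < 2 * 2 ^ (k + 1 - C.cls u) := by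
          refine Nat.lt_of_mul_lt_mul_left (a := 2 ^ C.cls u) ?_
          omega
        refine ⟨2 ^ (k + 1 - C.cls u) - 1 - b, ?_⟩
        rw [hb, e, ← Nat.mul_sub]
        congr 1
        omega
    · exact ⟨0, by simp⟩
  adj := by
    have hbot : ∀ (i : Fin p) (v : R.V), v = R.bot ⟨i.val, by omega⟩ ∨
        v = R.bot ⟨2 * p - 1 - i.val, by omega⟩ →
        GridEdge (k + 1) p i.val (2 ^ (k + 1)) (foldX p (C.x v)) (foldY k p (C.x v) (C.y v)) := by
      have e2 : 2 ^ (k + 2) = 2 * 2 ^ (k + 1) := by ring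
      have : 0 < 2 ^ (k + 1) := by positivity
      rintro i v (rfl | rfl) <;> right <;> left <;> rw [C.bot_x, C.bot_y] <;>
        simp only [foldX, foldY] <;> split_ifs <;> omega
    rintro (u | i) (v | j) h <;> simp only [Sum.elim_inl, Sum.elim_inr]
    · exact (C.adj u v (stepRG_adj_inl_inl.1 h)).fold (C.x_lt u) (C.x_lt v) (C.y_lt u) (C.y_lt v)
        (C.y_pos u)
    · exact (hbot j u (stepRG_adj_inr_inl.1 h.symm)).symm
    · exact hbot i v (stepRG_adj_inr_inl.1 h)
    · exact Or.inl ⟨rfl, stepRG_adj_inr_inr.1 h⟩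
  adj_iff := by
    rintro (u | i) (v | j) h <;> simp only [Sum.elim_inl, Sum.elim_inr] at h ⊢
    · exact stepRG_adj_inl_inl.trans (C.adj_iff u v h)
    · have := C.cls_le u
      omega
    · have := C.cls_le v
      omega
    · exact stepRG_adj_inr_inr
  top_x := fun i => by simp [stepRG, C.top_x, foldX]
  top_y := fun i => by simp [stepRG, C.top_x, C.top_y, foldY]
  bot_x := fun i => by
    simp only [stepRG, Sum.elim_inl, C.top_x, foldX]
    split_ifs <;> omega
  bot_y := fun i => by
    have e2 : 2 ^ (k + 2) = 2 ^ (k + 1 + 1) := rfl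
    simp only [stepRG, Sum.elim_inl, C.top_x, C.top_y, foldY]
    split_ifs <;> omega
  s_x := fun i hi => by
    by_cases h : i < k + 1
    · simp [stepRG, h, C.s_x i (by omega), foldX, hp]
    · simp [stepRG, h]
  s_y := fun i hi => by
    by_cases h : i < k + 1
    · simp [stepRG, h, C.s_x i (by omega), C.s_y i (by omega), foldY, hp]
    · obtain rfl : i = k + 1 := by omega
      simp [stepRG]
  s_cls := fun i hi => by
    by_cases h : i < k + 1
    · simp [stepRG, h, C.s_cls i (by omega)]
    · simp [stepRG, h]
      omega
  s_idx := fun i hi => by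
    by_cases h : i < k + 1
    · simp [stepRG, h, C.s_idx i (by omega)]
    · simp [stepRG, h]
  t_x := fun i hi => by
    simp only [stepRG, hi, if_true, Sum.elim_inl]
    rcases Nat.lt_or_ge i k with h | h
    · simp [C.t_x i h, foldX, hp]
    · obtain rfl : i = k := by omega
      rw [C.t_x_last]
      simp only [foldX]
      split_ifs <;> omega
  t_y := fun i hi => by
    simp only [stepRG, hi, if_true, Sum.elim_inl]
    rcases Nat.lt_or_ge i k with h | h
    · simp [C.t_x i h, C.t_y i h, foldY, hp]
    · obtain rfl : i = k := by omega
      have e2 : 2 ^ (i + 2) = 4 * 2 ^ i := by ring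
      rw [C.t_x_last, C.t_y_last]
      simp only [foldY]
      split_ifs <;> omega
  t_x_last := by simp [stepRG]
  t_y_last := by simp [stepRG]
  t_cls := fun i hi => by
    by_cases h : i < k + 1
    · simp [stepRG, h, C.t_cls i (by omega)]
    · simp [stepRG, h]
      omega
  t_idx := fun i hi => by
    by_cases h : i < k + 1
    · have e : k + 1 - i = (k - i) + 1 := by omega
      simp only [stepRG, h, if_true, Sum.elim_inl]
      rw [e, pow_succ, mul_assoc]
      exact C.t_idx i (by omega)
    · obtain rfl : i = k + 1 := by omega
      simp [stepRG]
      omega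

/-- The coordinates on `G_{k+1,p}`. -/
def gridCoords : (k p : ℕ) → (hp : 0 < p) → GridCoords k (GP k p hp)
  | 0, p, hp => baseCoords p hp
  | k + 1, p, _ => stepCoords _ (gridCoords k (2 * p) (by omega))

/-- Contribution of the edge from `(x, y)` to `(x', y')` to the crossing parity of the ray which
goes up from `(c, r)` immediately to the right of column `c`. -/
def rayCrossing (k p c r x y x' y' : ℕ) : ZMod 2 :=
  if y = y' ∧ (x + 1 = x' ∨ x' + 1 = x) then
    if (x = c ∨ x = c + 1) ∧ (x' = c ∨ x' = c + 1) ∧ y < r then 1 else 0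
  else if x = c ∧ x' = c ∧ c + 1 = p ∧ y + y' = 2 ^ (k + 1) then
    (if y < r then 1 else 0) + (if y' < r then 1 else 0)
  else 0

section RayCrossing

variable {k p c r x y x' y' : ℕ}

lemma rayCrossing_succ_row (h : ¬ (x = c ∧ y = r)) (h' : ¬ (x' = c ∧ y' = r)) :
    rayCrossing k p c r x y x' y' + rayCrossing k p c (r + 1) x y x' y' = 0 := by
  unfold rayCrossing
  split_ifs <;> first | rfl | omega

lemma rayCrossing_succ_col (h : ¬ (x = c + 1 ∧ y = r)) (h' : ¬ (x' = c + 1 ∧ y' = r))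
    (hc : c + 1 < p) (e : GridEdge k p x y x' y') :
    rayCrossing k p c r x y x' y' + rayCrossing k p (c + 1) r x y x' y' =
      (if x = c + 1 ∧ y < r then 1 else 0) + (if x' = c + 1 ∧ y' < r then 1 else 0) := by
  unfold rayCrossing
  rcases e with e | e | e | e
  · split_ifs <;> first | rfl | omega
  · split_ifs <;> first | rfl | omega
  · split_ifs <;> first | rfl | omega
  · have e1 := e.1
    have e2 := e.2.1
    split_ifs <;> first | rfl | omega

lemma rayCrossing_reflect {r' : ℕ}
    (g : ¬ (x = c ∧ y = r')) (g' : ¬ (x' = c ∧ y' = r')) (hc : c + 1 = p)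
    (hx : x < p) (hx' : x' < p) (hr : r + r' = 2 ^ (k + 1)) :
    rayCrossing k p c r x y x' y' + rayCrossing k p c r' x y x' y' = 0 := by
  unfold rayCrossing
  split_ifs <;> first | rfl | omega

lemma pow_succ_le_or_pow_succ_le {i j : ℕ} (h : i ≠ j) :
    2 ^ (i + 2) ≤ 2 ^ (j + 1) ∨ 2 ^ (j + 2) ≤ 2 ^ (i + 1) := by
  rcases lt_or_gt_of_ne h with h | h
  · exact Or.inl (Nat.pow_le_pow_right (by norm_num) (by omega))
  · exact Or.inr (Nat.pow_le_pow_right (by norm_num) (by omega))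

lemma rayCrossing_nest {r' i : ℕ} (h : ¬ (x = 0 ∧ y = r)) (h' : ¬ (x' = 0 ∧ y' = r))
    (g : ¬ (x = 0 ∧ y = r')) (g' : ¬ (x' = 0 ∧ y' = r')) (e : GridEdge k p x y x' y')
    (hr : 2 ^ (i + 1) < r) (hr' : r' < 2 ^ (i + 2)) (hrr : r < r')
    (hs : r + r' = 3 * 2 ^ (i + 1)) :
    rayCrossing k p 0 r x y x' y' + rayCrossing k p 0 r' x y x' y' =
      (if x = 0 ∧ r < y ∧ y < r' then 1 else 0) + (if x' = 0 ∧ r < y' ∧ y' < r' then 1 else 0) := by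
  unfold rayCrossing
  rcases e with e | e | e | ⟨e1, e2, j, -, ⟨e3, e4⟩, ⟨e5, e6⟩, e7⟩
  · split_ifs <;> first | rfl | omega
  · split_ifs <;> first | rfl | omega
  · split_ifs <;> first | rfl | omega
  · by_cases hij : i = j
    · subst hij
      split_ifs <;> first | rfl | omega
    · have := pow_succ_le_or_pow_succ_le hij
      split_ifs <;> first | rfl | omega

lemma rayCrossing_pow {m : ℕ} (h : ¬ (x = 0 ∧ y = 2 ^ m)) (h' : ¬ (x' = 0 ∧ y' = 2 ^ m))
    (e : GridEdge k p x y x' y') :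
    rayCrossing k p 0 (2 ^ m) x y x' y' =
      (if x = 0 ∧ y < 2 ^ m then 1 else 0) + (if x' = 0 ∧ y' < 2 ^ m then 1 else 0) := by
  unfold rayCrossing
  rcases e with e | e | e | ⟨e1, e2, j, -, ⟨e3, e4⟩, ⟨e5, e6⟩, e7⟩
  · split_ifs <;> first | rfl | omega
  · split_ifs <;> first | rfl | omega
  · split_ifs <;> first | rfl | omega
  · have : 2 ^ m ≤ 2 ^ (j + 1) ∨ 2 ^ (j + 2) ≤ 2 ^ m := by
      rcases Nat.lt_or_ge (j + 1) m with hm | hm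
      · exact Or.inr (Nat.pow_le_pow_right (by norm_num) hm)
      · exact Or.inl (Nat.pow_le_pow_right (by norm_num) hm)
    split_ifs <;> first | rfl | omega

lemma rayCrossing_zero : rayCrossing k p c 0 x y x' y' = 0 := by
  simp [rayCrossing]

lemma exists_of_rayCrossing_ne {r' : ℕ}
    (h : rayCrossing k p c r x y x' y' ≠ rayCrossing k p c r' x y x' y') (hr : r ≤ r') :
    (x = c ∧ r ≤ y ∧ y < r') ∨ (x' = c ∧ r ≤ y' ∧ y' < r') := by
  contrapose! h
  unfold rayCrossing
  split_ifs <;> first | rfl | omega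

end RayCrossing

lemma sum_darts_map_add {V : Type*} {G : SimpleGraph V} (f : V → ZMod 2) {u v : V}
    (w : G.Walk u v) : (w.darts.map fun d => f d.fst + f d.snd).sum = f u + f v := by
  induction w with
  | nil => exact (CharTwo.add_self_eq_zero _).symm
  | @cons _ b _ h w ih =>
    simp only [Walk.darts_cons, List.map_cons, List.sum_cons, ih]
    linear_combination CharTwo.add_self_eq_zero (f b)

namespace GridCoords

variable {k p : ℕ} {R : RowedGraph p} (C : GridCoords k R)

/-- Parity of the number of crossings of the walk `w` with the ray going up from `(c, r)`. -/
def rayParity {u v : R.V} (w : R.G.Walk u v) (c r : ℕ) : ZMod 2 :=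
  (w.darts.map fun d =>
    rayCrossing k p c r (C.x d.fst) (C.y d.fst) (C.x d.snd) (C.y d.snd)).sum

section RayParity

variable {u v : R.V} (w : R.G.Walk u v)

/-- The walk `w` does not visit the point `(c, r)`. -/
def Avoids (c r : ℕ) : Prop := ∀ a ∈ w.support, ¬ (C.x a = c ∧ C.y a = r)

lemma rayParity_add_rayParity {c r c' r' : ℕ} (f : R.V → ZMod 2)
    (h : ∀ a ∈ w.support, ∀ b ∈ w.support, R.G.Adj a b →
      rayCrossing k p c r (C.x a) (C.y a) (C.x b) (C.y b) +
        rayCrossing k p c' r' (C.x a) (C.y a) (C.x b) (C.y b) = f a + f b) :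
    C.rayParity w c r + C.rayParity w c' r' = f u + f v := by
  rw [rayParity, rayParity, ← List.sum_map_add, ← sum_darts_map_add f w]
  congr 1
  refine List.map_congr_left fun d hd => h _ (w.dart_fst_mem_support_of_mem_darts hd) _
    (w.dart_snd_mem_support_of_mem_darts hd) d.adj

variable {w}

lemma rayParity_succ_row {c r : ℕ} (h : C.Avoids w c r) :
    C.rayParity w c r = C.rayParity w c (r + 1) := by
  refine CharTwo.add_eq_zero.1 ((C.rayParity_add_rayParity w (fun _ => 0) ?_).trans (add_zero 0))
  intro a ha b hb _
  rw [rayCrossing_succ_row (h a ha) (h b hb), add_zero]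

lemma rayParity_succ_col {c r : ℕ} (h : C.Avoids w (c + 1) r) (hc : c + 1 < p)
    (hu : C.x u = 0) (hv : C.x v = 0) :
    C.rayParity w c r = C.rayParity w (c + 1) r := by
  refine CharTwo.add_eq_zero.1 ((C.rayParity_add_rayParity w
    (fun a => if C.x a = c + 1 ∧ C.y a < r then 1 else 0) ?_).trans ?_)
  · intro a ha b hb hab
    exact rayCrossing_succ_col (h a ha) (h b hb) hc (C.adj a b hab)
  · simp [hu, hv]

lemma rayParity_reflect {c r r' : ℕ} (h : C.Avoids w c r')
    (hc : c + 1 = p) (hr : r + r' = 2 ^ (k + 1)) :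
    C.rayParity w c r = C.rayParity w c r' := by
  refine CharTwo.add_eq_zero.1 ((C.rayParity_add_rayParity w (fun _ => 0) ?_).trans (add_zero 0))
  intro a ha b hb _
  rw [rayCrossing_reflect (h a ha) (h b hb) hc (C.x_lt a) (C.x_lt b) hr,
    add_zero]

lemma rayParity_nest {r r' i : ℕ} (h : C.Avoids w 0 r) (h' : C.Avoids w 0 r')
    (hr : 2 ^ (i + 1) < r) (hr' : r' < 2 ^ (i + 2)) (hrr : r < r')
    (hs : r + r' = 3 * 2 ^ (i + 1))
    (hu : ¬ (2 ^ (i + 1) < C.y u ∧ C.y u < 2 ^ (i + 2)))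
    (hv : ¬ (2 ^ (i + 1) < C.y v ∧ C.y v < 2 ^ (i + 2))) :
    C.rayParity w 0 r = C.rayParity w 0 r' := by
  refine CharTwo.add_eq_zero.1 ((C.rayParity_add_rayParity w
    (fun a => if C.x a = 0 ∧ r < C.y a ∧ C.y a < r' then 1 else 0) ?_).trans ?_)
  · intro a ha b hb hab
    exact rayCrossing_nest (h a ha) (h b hb) (h' a ha) (h' b hb) (C.adj a b hab) hr hr' hrr hs
  · rw [if_neg (by omega), if_neg (by omega), add_zero]

lemma rayParity_pow {m : ℕ} (h : C.Avoids w 0 (2 ^ m)) :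
    C.rayParity w 0 (2 ^ m) = (if C.x u = 0 ∧ C.y u < 2 ^ m then 1 else 0) +
      (if C.x v = 0 ∧ C.y v < 2 ^ m then 1 else 0) := by
  rw [← sum_darts_map_add (fun a => if C.x a = 0 ∧ C.y a < 2 ^ m then (1 : ZMod 2) else 0) w]
  rw [rayParity]
  congr 1
  exact List.map_congr_left fun d hd => rayCrossing_pow
    (h _ (w.dart_fst_mem_support_of_mem_darts hd)) (h _ (w.dart_snd_mem_support_of_mem_darts hd))
    (C.adj _ _ d.adj)

lemma rayParity_zero (c : ℕ) : C.rayParity w c 0 = 0 := by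
  simp [rayParity, rayCrossing_zero]

lemma exists_of_rayParity_ne {c r r' : ℕ} (h : C.rayParity w c r ≠ C.rayParity w c r')
    (hr : r ≤ r') : ∃ a ∈ w.support, C.x a = c ∧ r ≤ C.y a ∧ C.y a < r' := by
  contrapose! h
  rw [rayParity, rayParity]
  congr 1
  refine List.map_congr_left fun d hd => ?_
  by_contra hne
  rcases exists_of_rayCrossing_ne hne hr with ⟨h1, h2, h3⟩ | ⟨h1, h2, h3⟩
  · exact absurd (h _ (w.dart_fst_mem_support_of_mem_darts hd) h1 h2) (by omega)
  · exact absurd (h _ (w.dart_snd_mem_support_of_mem_darts hd) h1 h2) (by omega)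

end RayParity

end GridCoords

namespace GridCoords

variable {k p : ℕ} {R : RowedGraph p} (C : GridCoords k R)

lemma avoids_of_notMem {u v a : R.V} {w : R.G.Walk u v} (ha : a ∉ w.support) :
    C.Avoids w (C.x a) (C.y a) := by
  rintro b hb ⟨h, h'⟩
  exact ha (C.xy_inj b a h h' ▸ hb)

section Parity

variable {j : ℕ} (hj : j < k) (w : R.G.Walk (R.s j) (R.t j))
include hj

lemma rayParity_eq_of_adj {a b : R.V} (hab : R.G.Adj a b) (ha : a ∉ w.support)
    (hb : b ∉ w.support)
    (ha' : ¬ (C.x a = 0 ∧ 2 ^ (j + 1) < C.y a ∧ C.y a < 3 * 2 ^ j))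
    (hb' : ¬ (C.x b = 0 ∧ 2 ^ (j + 1) < C.y b ∧ C.y b < 3 * 2 ^ j)) :
    C.rayParity w (C.x a) (C.y a) = C.rayParity w (C.x b) (C.y b) := by
  have hs := C.s_x j hj.le
  have ht := C.t_x j hj
  have Ha := C.avoids_of_notMem ha
  have Hb := C.avoids_of_notMem hb
  have ex : ∀ m, 2 ^ (m + 1) = 2 * 2 ^ m := fun m => pow_succ' 2 m
  have hsy := C.s_y j hj.le
  have hty := C.t_y j hj
  have nest : ∀ i ≠ j, ∀ y, y = 2 ^ j ∨ y = 3 * 2 ^ j → ¬ (2 ^ (i + 1) < y ∧ y < 2 ^ (i + 2)) := by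
    intro i hij y hy
    have := pow_succ_le_or_pow_succ_le hij
    have : 2 ^ j ≤ 2 ^ (i + 1) ∨ 2 ^ (i + 2) ≤ 2 ^ j := by
      rcases Nat.lt_or_ge (i + 1) j with h | h
      · exact Or.inr (Nat.pow_le_pow_right (by norm_num) h)
      · exact Or.inl (Nat.pow_le_pow_right (by norm_num) h)
    have := ex i
    have := ex j
    have : 2 ^ (i + 2) = 4 * 2 ^ i := by ring
    have : 2 ^ (j + 2) = 4 * 2 ^ j := by ring
    omega
  have key : ∀ i, C.x a = 0 → C.x b = 0 → (2 ^ (i + 1) < C.y a ∧ C.y a < 2 ^ (i + 2)) →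
      (2 ^ (i + 1) < C.y b ∧ C.y b < 2 ^ (i + 2)) → C.y a + C.y b = 3 * 2 ^ (i + 1) → i ≠ j := by
    rintro i hxa hxb h1 h2 h3 rfl
    have hne : C.y a ≠ C.y b := fun h => hab.ne (C.xy_inj a b (hxa.trans hxb.symm) h)
    have := ex i
    omega
  rcases C.adj a b hab with ⟨h, h1 | h1⟩ | ⟨h, h1 | h1⟩ | ⟨h, h1, h2⟩ | ⟨h, h', i, -, h1, h2, h3⟩
  · rw [h, ← h1]
    rw [← h1] at Hb
    exact C.rayParity_succ_col Hb (h1 ▸ C.x_lt b) hs ht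
  · rw [← h, ← h1]
    rw [← h1] at Ha
    exact (C.rayParity_succ_col Ha (h1 ▸ C.x_lt a) hs ht).symm
  · rw [h, ← h1]
    rw [h] at Ha
    exact C.rayParity_succ_row Ha
  · rw [h, ← h1]
    exact (C.rayParity_succ_row Hb).symm
  · rw [← h] at Hb ⊢
    exact C.rayParity_reflect Hb h1 h2
  · have hij := key i h h' h1 h2 h3
    have hu := nest i hij _ (Or.inl hsy)
    have hv := nest i hij _ (Or.inr hty)
    have hne : C.y a ≠ C.y b := fun e => hab.ne (C.xy_inj a b (h.trans h'.symm) e)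
    rw [h] at Ha ⊢
    rw [h'] at Hb ⊢
    rcases lt_or_gt_of_ne hne with hlt | hlt
    · exact C.rayParity_nest Ha Hb h1.1 h2.2 hlt h3 hu hv
    · exact (C.rayParity_nest Hb Ha h2.1 h1.2 hlt (by omega) hu hv).symm

lemma rayParity_eq_start {a b : R.V} (q : R.G.Walk a b)
    (hq : ∀ c ∈ q.support, c ∉ w.support)
    (hq' : ∀ c ∈ q.support, ¬ (C.x c = 0 ∧ 2 ^ (j + 1) < C.y c ∧ C.y c < 3 * 2 ^ j)) :
    ∀ c ∈ q.support, C.rayParity w (C.x c) (C.y c) = C.rayParity w (C.x a) (C.y a) := by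
  induction q with
  | nil =>
    intro c hc
    rw [Walk.mem_support_nil_iff.1 hc]
  | @cons a b d h q ih =>
    intro c hc
    rw [Walk.support_cons, List.mem_cons] at hc
    rcases hc with rfl | hc
    · rfl
    · have hb : b ∈ (Walk.cons h q).support := List.mem_cons_of_mem _ q.start_mem_support
      rw [ih (fun c hc => hq c (List.mem_cons_of_mem _ hc))
        (fun c hc => hq' c (List.mem_cons_of_mem _ hc)) c hc]
      exact (C.rayParity_eq_of_adj hj w h (hq _ (Walk.start_mem_support _)) (hq _ hb)
        (hq' _ (Walk.start_mem_support _)) (hq' _ hb)).symm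

lemma rayParity_start {m : ℕ} (hm : j < m) (hmk : m ≤ k) (h : R.s m ∉ w.support) :
    C.rayParity w (C.x (R.s m)) (C.y (R.s m)) = if m = j + 1 then 1 else 0 := by
  have H := C.avoids_of_notMem h
  rw [C.s_x m hmk, C.s_y m hmk] at H ⊢
  rw [C.rayParity_pow H, C.s_x j hj.le, C.s_y j hj.le, C.t_x j hj, C.t_y j hj]
  have h1 : 2 ^ j < 2 ^ m := Nat.pow_lt_pow_right (by norm_num) hm
  have ex : 2 ^ (j + 1) = 2 * 2 ^ j := pow_succ' 2 j
  have ex' : 2 ^ (j + 2) = 4 * 2 ^ j := by ring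
  split_ifs with h2 h3 h4 h5 h6
  · subst h4
    omega
  · rfl
  · simp
  · have : 2 ^ (j + 2) ≤ 2 ^ m := Nat.pow_le_pow_right (by norm_num) (by omega)
    omega
  all_goals omega

lemma rayParity_bottom {c : ℕ} (hc : c < p) : C.rayParity w c (2 ^ (k + 1)) = 0 := by
  have hav : ∀ c, C.Avoids w c (2 ^ (k + 1)) := fun c a _ h => (C.y_lt a).ne h.2
  induction c with
  | zero =>
    have h : 2 ^ (j + 2) ≤ 2 ^ (k + 1) := Nat.pow_le_pow_right (by norm_num) (by omega)
    have ex' : 2 ^ (j + 2) = 4 * 2 ^ j := by ring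
    have : 0 < 2 ^ j := by positivity
    rw [C.rayParity_pow (hav 0), C.s_x j hj.le, C.s_y j hj.le, C.t_x j hj, C.t_y j hj,
      if_pos (by omega), if_pos (by omega)]
    rfl
  | succ c ih =>
    rw [← C.rayParity_succ_col (hav _) hc (C.s_x j hj.le) (C.t_x j hj)]
    exact ih (by omega)

end Parity

section DisjointPaths

variable (w : ∀ i : Fin (k + 1), R.G.Walk (R.s i) (R.t i))
  (hw : ∀ i j, i ≠ j → ∀ a ∈ (w i).support, a ∉ (w j).support)
include hw

/-- Points of the path number `j` keep distance `2 ^ j` within their column from all paths of larger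
number, and from the rows above and below the drawing. -/
lemma spacing (j : ℕ) (hj : j < k + 1) : ∀ u ∈ (w ⟨j, hj⟩).support,
    (∀ m : Fin (k + 1), j < m → ∀ v ∈ (w m).support, C.x u = C.x v →
      C.y u + 2 ^ j ≤ C.y v ∨ C.y v + 2 ^ j ≤ C.y u) ∧
    2 ^ j ≤ C.y u ∧ C.y u + 2 ^ j ≤ 2 ^ (k + 1) := by
  induction j with
  | zero =>
    intro u hu
    refine ⟨fun m hm v hv huv => ?_, C.y_pos u, C.y_lt u⟩
    have hne : C.y u ≠ C.y v := by
      intro h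
      obtain rfl := C.xy_inj u v huv h
      exact hw ⟨0, hj⟩ m (by rintro rfl; exact lt_irrefl _ hm) u hu hv
    omega
  | succ j ih =>
    have hjk : j < k := by omega
    have hj' : j < k + 1 := by omega
    have ih := ih hj'
    set q := w ⟨j, hj'⟩ with hq
    have ex : 2 ^ (j + 1) = 2 * 2 ^ j := pow_succ' 2 j
    have hpos : 0 < 2 ^ j := by positivity
    have color : ∀ m : Fin (k + 1), j < m → ∀ v ∈ (w m).support,
        C.rayParity q (C.x v) (C.y v) = if m.val = j + 1 then 1 else 0 := by
      intro m hm v hv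
      have hdis : ∀ c ∈ (w m).support, c ∉ q.support :=
        hw m ⟨j, hj'⟩ (by rintro rfl; exact lt_irrefl _ hm)
      rw [C.rayParity_eq_start hjk q (w m) hdis ?_ v hv]
      · exact C.rayParity_start hjk q hm (by omega) (hdis _ (Walk.start_mem_support _))
      · rintro c hc ⟨h1, h2, h3⟩
        have := (ih _ q.end_mem_support).1 m hm c hc ((C.t_x j hjk).trans h1.symm)
        have hty := C.t_y j hjk
        simp only at this
        omega
    have sep : ∀ c r r', r ≤ r' → C.rayParity q c r ≠ C.rayParity q c r' →
        ∃ a ∈ q.support, C.x a = c ∧ r ≤ C.y a ∧ C.y a < r' :=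
      fun c r r' h h' => C.exists_of_rayParity_ne h' h
    intro u hu
    have hcu : C.rayParity q (C.x u) (C.y u) = 1 :=
      (color ⟨j + 1, hj⟩ (Nat.lt_succ_self j) u hu).trans (if_pos rfl)
    have near : ∀ a ∈ q.support, C.x a = C.x u →
        C.y a + 2 ^ j ≤ C.y u ∨ C.y u + 2 ^ j ≤ C.y a :=
      fun a ha => (ih a ha).1 ⟨j + 1, hj⟩ (Nat.lt_succ_self j) u hu
    refine ⟨fun m hm v hv huv => ?_, ?_, ?_⟩
    · have hcv : C.rayParity q (C.x u) (C.y v) = 0 := by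
        rw [huv]
        exact (color m (by omega) v hv).trans (if_neg (by omega))
      rcases le_total (C.y u) (C.y v) with h | h
      · obtain ⟨a, ha, h1, h2, h3⟩ := sep _ _ _ h (by rw [hcu, hcv]; exact one_ne_zero)
        have := near a ha h1
        have := (ih a ha).1 m (by omega) v hv (h1.trans huv)
        omega
      · obtain ⟨a, ha, h1, h2, h3⟩ := sep _ _ _ h (by rw [hcu, hcv]; exact zero_ne_one)
        have := near a ha h1
        have := (ih a ha).1 m (by omega) v hv (h1.trans huv)
        omega
    · obtain ⟨a, ha, h1, h2, h3⟩ := sep (C.x u) _ _ (Nat.zero_le (C.y u))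
        (by rw [hcu, C.rayParity_zero]; exact zero_ne_one)
      have := near a ha h1
      have := (ih a ha).2.1
      omega
    · obtain ⟨a, ha, h1, h2, h3⟩ := sep (C.x u) _ _ (C.y_lt u).le
        (by rw [hcu, C.rayParity_bottom hjk q (C.x_lt u)]; exact one_ne_zero)
      have := near a ha h1
      have := (ih a ha).2.2
      omega

end DisjointPaths

lemma cls_eq_of_y {u : R.V} {j b : ℕ} (h : C.y u = 2 ^ j * (2 * b + 1)) : C.cls u = j := by
  obtain ⟨b', hb'⟩ := C.y_cls u
  have aux : ∀ m n c d : ℕ, m < n → 2 ^ m * (2 * c + 1) ≠ 2 ^ n * (2 * d + 1) := by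
    intro m n c d hmn e
    obtain ⟨l, rfl⟩ := Nat.exists_eq_add_of_lt hmn
    have e' : 2 * c + 1 = 2 * (2 ^ l * (2 * d + 1)) := by
      refine Nat.eq_of_mul_eq_mul_left (show 0 < 2 ^ m by positivity) ?_
      rw [e]
      ring
    omega
  rw [h] at hb'
  rcases lt_trichotomy (C.cls u) j with h1 | h1 | h1
  · exact absurd hb'.symm (aux _ _ _ _ h1)
  · exact h1
  · exact absurd hb' (aux _ _ _ _ h1)

lemma lt_cls_of_dvd {u : R.V} {j : ℕ} (h : 2 ^ (j + 1) ∣ C.y u) : j < C.cls u := by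
  by_contra! hle
  obtain ⟨b, hb⟩ := C.y_cls u
  obtain ⟨c, hc⟩ := h
  obtain ⟨d, hd⟩ := Nat.exists_eq_add_of_le hle
  have e' : 2 * b + 1 = 2 * (2 ^ d * c) := by
    refine Nat.eq_of_mul_eq_mul_left (show 0 < 2 ^ C.cls u by positivity) ?_
    rw [← hb, hc]
    nth_rewrite 1 [hd]
    ring
  omega

/-- A walk that stays in one class and passes from index at most `a` to larger index uses the edge
from index `a` to index `a + 1`. -/
lemma exists_mem_edges_of_idx {u v : R.V} (w : R.G.Walk u v)
    (hcls : ∀ c ∈ w.support, C.cls c = C.cls u) {a : ℕ} (hu : C.idx u ≤ a) (hv : a < C.idx v) :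
    ∃ b ∈ w.support, ∃ c ∈ w.support, C.idx b = a ∧ C.idx c = a + 1 ∧ s(b, c) ∈ w.edges := by
  induction w with
  | nil => omega
  | @cons u b v h w ih =>
    have hb : C.cls b = C.cls u := hcls b (List.mem_cons_of_mem _ w.start_mem_support)
    rcases Nat.lt_or_ge a (C.idx b) with hab | hab
    · have := (C.adj_iff u b hb.symm).1 h
      exact ⟨u, Walk.start_mem_support _, b, List.mem_cons_of_mem _ w.start_mem_support,
        by omega, by omega, by simp⟩
    · obtain ⟨c, hc, d, hd, h1, h2, h3⟩ := ih
        (fun c hc => (hcls c (List.mem_cons_of_mem _ hc)).trans hb.symm) hab hv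
      exact ⟨c, List.mem_cons_of_mem _ hc, d, List.mem_cons_of_mem _ hd, h1, h2,
        List.mem_cons_of_mem _ h3⟩

section DisjointPaths

variable (w : ∀ i : Fin (k + 1), R.G.Walk (R.s i) (R.t i))

lemma mem_support_of_cls (j : Fin (k + 1)) (hj : ∀ u ∈ (w j).support, C.cls u = j) {u : R.V}
    (hu : C.cls u = j) : u ∈ (w j).support := by
  have hs := C.s_cls j (by omega)
  have hs' := C.s_idx j (by omega)
  have ht := C.t_cls j (by omega)
  have ht' := C.t_idx j (by omega)
  have hlt := C.idx_lt u
  rw [hu] at hlt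
  rcases Nat.lt_or_ge (C.idx u) (C.idx (R.t j)) with h | h
  · obtain ⟨b, hb, -, -, h1, -⟩ := C.exists_mem_edges_of_idx (w j)
      (fun c hc => (hj c hc).trans hs.symm) (by omega : C.idx (R.s j) ≤ C.idx u) h
    rwa [C.ci_inj u b (hu.trans (hj b hb).symm) h1.symm]
  · rw [C.ci_inj u (R.t j) (hu.trans ht.symm) (by omega)]
    exact Walk.end_mem_support _

lemma mem_edges_of_cls (j : Fin (k + 1)) (hj : ∀ u ∈ (w j).support, C.cls u = j) {u v : R.V}
    (hu : C.cls u = j) (hv : C.cls v = j) (huv : C.idx u + 1 = C.idx v) :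
    s(u, v) ∈ (w j).edges := by
  have hs := C.s_cls j (by omega)
  have hs' := C.s_idx j (by omega)
  have ht' := C.t_idx j (by omega)
  have hlt := C.idx_lt v
  rw [hv] at hlt
  obtain ⟨b, hb, c, hc, h1, h2, h3⟩ := C.exists_mem_edges_of_idx (w j)
    (fun c hc => (hj c hc).trans hs.symm) (by omega : C.idx (R.s j) ≤ C.idx u)
    (by omega : C.idx u < C.idx (R.t j))
  rwa [C.ci_inj u b (hu.trans (hj b hb).symm) h1.symm,
    C.ci_inj v c (hv.trans (hj c hc).symm) (by omega)]

/-- Disjoint paths joining `s_i` to `t_i` stay in their classes. -/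
lemma cls_eq_of_mem_support
    (hw : ∀ i j, i ≠ j → ∀ a ∈ (w i).support, a ∉ (w j).support) (j : Fin (k + 1)) :
    ∀ u ∈ (w j).support, C.cls u = j := by
  induction j using WellFoundedGT.induction with
  | ind j ih =>
  intro u hu
  have owner : ∀ v, j < C.cls v → ∃ m : Fin (k + 1), j < m ∧ v ∈ (w m).support := by
    intro v hv
    refine ⟨⟨C.cls v, by have := C.cls_le v; omega⟩, hv, ?_⟩
    exact C.mem_support_of_cls w _ (ih _ hv) rfl
  obtain ⟨h1, h2, h3⟩ := C.spacing w hw j j.2 u hu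
  set N := 2 ^ (j.val + 1) with hN
  have eN : N = 2 * 2 ^ j.val := pow_succ' 2 _
  have hNpos : 0 < N := by positivity
  have far : ∀ c, N ∣ c → c ≤ 2 ^ (k + 1) → C.y u + 2 ^ j.val ≤ c ∨ c + 2 ^ j.val ≤ C.y u := by
    intro c hc hck
    rcases Nat.eq_zero_or_pos c with rfl | hpos
    · omega
    rcases hck.eq_or_lt with rfl | hlt
    · omega
    obtain ⟨v, hv, hv'⟩ := C.xy_surj (C.x u) (C.x_lt u) c hpos hlt
    obtain ⟨m, hm, hvm⟩ := owner v (C.lt_cls_of_dvd (hv' ▸ hc))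
    have := h1 m hm v hvm hv.symm
    omega
  obtain ⟨M, hM⟩ : N ∣ 2 ^ (k + 1) := pow_dvd_pow 2 (by omega)
  have hdiv := Nat.div_add_mod (C.y u) N
  have hmod := Nat.mod_lt (C.y u) hNpos
  have hq : C.y u / N < M := by
    refine (Nat.div_lt_iff_lt_mul hNpos).2 ?_
    rw [mul_comm, ← hM]
    exact C.y_lt u
  have hq1 : N * (C.y u / N + 1) ≤ 2 ^ (k + 1) := hM ▸ Nat.mul_le_mul_left N hq
  have f1 := far (N * (C.y u / N)) (dvd_mul_right _ _) ((Nat.mul_div_le _ _).trans (C.y_lt u).le)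
  have f2 := far (N * (C.y u / N + 1)) (dvd_mul_right _ _) hq1
  rw [Nat.mul_succ] at f2
  refine C.cls_eq_of_y (b := C.y u / N) ?_
  have : 2 ^ j.val * (2 * (C.y u / N) + 1) = N * (C.y u / N) + 2 ^ j.val := by
    rw [eN]
    ring
  omega

end DisjointPaths

end GridCoords
/-- The ends of a path component are determined by the component. -/
lemma IsPathComponent.ends_eq {α : Type*} {H : SimpleGraph α} {c : H.ConnectedComponent}
    {x y x' y' : α} (h : IsPathComponent H c x y) (h' : IsPathComponent H c x' y') :
    s(x, y) = s(x', y') := by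
  classical
  obtain ⟨w, hw, hs, he⟩ := h
  obtain ⟨w', hw', hs', he'⟩ := h'
  by_cases hxy : x = y
  · subst hxy
    rw [(Walk.isPath_iff_nil.1 hw).eq_nil] at hs
    have hx := (hs x').2 ((hs' x').1 w'.start_mem_support)
    have hy := (hs y').2 ((hs' y').1 w'.end_mem_support)
    rw [Walk.mem_support_nil_iff] at hx hy
    rw [hx, hy]
  · have hperm : w.edges.Perm w'.edges := by
      refine (List.perm_ext_iff_of_nodup hw.isTrail.edges_nodup hw'.isTrail.edges_nodup).2 ?_
      intro e
      induction e with
      | _ u v =>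
      exact ⟨fun h => he' u v ((hs u).1 (w.fst_mem_support_of_mem_edges h))
          (w.adj_of_mem_edges h),
        fun h => he u v ((hs' u).1 (w'.fst_mem_support_of_mem_edges h))
          (w'.adj_of_mem_edges h)⟩
    have key : ∀ z, z = x ∨ z = y → z = x' ∨ z = y' := by
      intro z hz
      have h1 := hw.isTrail.even_countP_edges_iff z
      have h2 := hw'.isTrail.even_countP_edges_iff z
      rw [hperm.countP_eq] at h1
      tauto
    have hx := key x (Or.inl rfl)
    have hy := key y (Or.inr rfl)
    rw [Sym2.eq_iff]
    rcases hx with rfl | rfl <;> rcases hy with rfl | rfl <;> tauto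

/-- A path component of a subgraph, seen as a walk in the ambient graph. -/
lemma IsPathComponent.exists_walk {V : Type*} {G : SimpleGraph V} {L : G.Subgraph}
    {c : L.coe.ConnectedComponent} {x y : L.verts} (h : IsPathComponent L.coe c x y) {a b : V}
    (hab : s(a, b) = s((x : V), (y : V))) :
    ∃ w : G.Walk a b, (∀ v : L.verts, (v : V) ∈ w.support ↔ v ∈ c.supp) ∧
      (∀ v ∈ w.support, v ∈ L.verts) ∧ ∀ u v, s(u, v) ∈ w.edges → L.Adj u v := by
  obtain ⟨w, -, hs, -⟩ := h
  have main : ∃ w : G.Walk (L.hom x) (L.hom y), (∀ v : L.verts, (v : V) ∈ w.support ↔ v ∈ c.supp) ∧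
      (∀ v ∈ w.support, v ∈ L.verts) ∧ ∀ u v, s(u, v) ∈ w.edges → L.Adj u v := by
    refine ⟨w.map L.hom, fun v => ?_, fun v hv => ?_, fun u v huv => ?_⟩
    · rw [← hs, Walk.support_map, List.mem_map]
      exact ⟨fun ⟨z, hz, e⟩ => Subtype.ext e ▸ hz, fun hv => ⟨v, hv, rfl⟩⟩
    · rw [Walk.support_map, List.mem_map] at hv
      obtain ⟨z, -, rfl⟩ := hv
      exact z.2
    · rw [Walk.edges_map, List.mem_map] at huv
      obtain ⟨e, he, heq⟩ := huv
      induction e with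
      | _ z z' =>
      have hadj : L.Adj z z' := w.adj_of_mem_edges he
      rw [Sym2.map_mk, Sym2.eq_iff] at heq
      rcases heq with ⟨rfl, rfl⟩ | ⟨rfl, rfl⟩
      · exact hadj
      · exact hadj.symm
  obtain ⟨w, h1, h2, h3⟩ : ∃ w : G.Walk (x : V) y, (∀ v : L.verts, (v : V) ∈ w.support ↔
      v ∈ c.supp) ∧ (∀ v ∈ w.support, v ∈ L.verts) ∧ ∀ u v, s(u, v) ∈ w.edges → L.Adj u v := main
  rcases Sym2.eq_iff.1 hab with ⟨rfl, rfl⟩ | ⟨rfl, rfl⟩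
  · exact ⟨w, h1, h2, h3⟩
  · refine ⟨w.reverse, ?_, ?_, ?_⟩
    · simpa using h1
    · simpa using h2
    · simpa using h3

section Lines

variable {α : Type*} {H : SimpleGraph α} {cls idx : α → ℕ}
  (inj : ∀ u v, cls u = cls v → idx u = idx v → u = v)
  (hadj : ∀ u v, H.Adj u v ↔ cls u = cls v ∧ (idx u + 1 = idx v ∨ idx v + 1 = idx u))
  (surj : ∀ z, ∀ n ≤ idx z, ∃ u, cls u = cls z ∧ idx u = n)
include inj hadj surj

lemma exists_path_of_idx {x : α} (hx : idx x = 0) (n : ℕ) :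
    ∀ z, cls z = cls x → idx z = n → ∃ w : H.Walk x z, w.IsPath ∧
      (∀ v, v ∈ w.support ↔ cls v = cls x ∧ idx v ≤ n) ∧
      ∀ u v, cls u = cls x → H.Adj u v → idx u ≤ n → idx v ≤ n → s(u, v) ∈ w.edges := by
  induction n with
  | zero =>
    intro z hz hz'
    obtain rfl := inj z x hz (hz'.trans hx.symm)
    refine ⟨Walk.nil, Walk.IsPath.nil, fun v => ?_, fun u v _ huv h h' => ?_⟩
    · rw [Walk.mem_support_nil_iff]
      refine ⟨?_, fun h => inj v z h.1 (by omega)⟩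
      rintro rfl
      exact ⟨rfl, hz'.le⟩
    · have := ((hadj u v).1 huv).2
      omega
  | succ n ih =>
    intro z hz hz'
    obtain ⟨y, hy, hy'⟩ := surj z n (by omega)
    have hyz : H.Adj y z := (hadj y z).2 ⟨hy, Or.inl (by omega)⟩
    obtain ⟨w, hw, hs, he⟩ := ih y (hy.trans hz) hy'
    have hzw : z ∉ w.support := fun h => by
      have := ((hs z).1 h).2
      omega
    refine ⟨w.concat hyz, hw.concat hzw hyz, fun v => ?_, fun u v hu huv h h' => ?_⟩
    · rw [Walk.support_concat, List.mem_append, List.mem_singleton, hs]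
      constructor
      · rintro (h | rfl)
        · exact ⟨h.1, by omega⟩
        · exact ⟨hz, hz'.le⟩
      · rintro ⟨h, h'⟩
        rcases h'.lt_or_eq with h' | h'
        · exact Or.inl ⟨h, by omega⟩
        · exact Or.inr (inj v z (h.trans hz.symm) (h'.trans hz'.symm))
    · rw [Walk.edges_concat, List.concat_eq_append, List.mem_append, List.mem_singleton]
      obtain ⟨hc, hi⟩ := (hadj u v).1 huv
      by_cases hmax : idx u ≤ n ∧ idx v ≤ n
      · exact Or.inl (he u v hu huv hmax.1 hmax.2)
      · right
        rcases hi with hi | hi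
        · rw [inj u y (by omega) (by omega), inj v z (by omega) (by omega)]
        · rw [inj v y (by omega) (by omega), inj u z (by omega) (by omega), Sym2.eq_swap]

omit inj surj in
lemma cls_eq_of_reachable {u v : α} (h : H.Reachable u v) : cls u = cls v := by
  obtain ⟨w⟩ := h
  induction w with
  | nil => rfl
  | cons h _ ih => exact ((hadj _ _).1 h).1.trans ih

lemma connectedComponentMk_eq_iff_cls {x v : α} (hx : idx x = 0) :
    H.connectedComponentMk v = H.connectedComponentMk x ↔ cls v = cls x := by
  rw [ConnectedComponent.eq]
  refine ⟨cls_eq_of_reachable hadj, fun h => ?_⟩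
  obtain ⟨w, -⟩ := exists_path_of_idx inj hadj surj hx _ v h rfl
  exact ⟨w.reverse⟩

lemma isPathComponent_of_idx {x y : α} (hx : idx x = 0) (hy : cls y = cls x)
    (hmax : ∀ u, cls u = cls x → idx u ≤ idx y) :
    IsPathComponent H (H.connectedComponentMk x) x y := by
  obtain ⟨w, hw, hs, he⟩ := exists_path_of_idx inj hadj surj hx _ y hy rfl
  have hsupp : ∀ v, v ∈ (H.connectedComponentMk x).supp ↔ cls v = cls x := fun v =>
    (ConnectedComponent.mem_supp_iff _ _).trans
      (connectedComponentMk_eq_iff_cls inj hadj surj hx)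
  refine ⟨w, hw, fun v => ?_, fun u v hu huv => ?_⟩
  · rw [hs, hsupp]
    exact ⟨fun h => h.1, fun h => ⟨h, hmax v h⟩⟩
  · have hu' := (hsupp u).1 hu
    exact he u v hu' huv (hmax u hu') (hmax v (((hadj u v).1 huv).1.symm.trans hu'))

end Lines

namespace GridCoords

variable {k p : ℕ} {R : RowedGraph p} (C : GridCoords k R)

/-- The canonical linkage: the subgraph of all edges inside a class. -/
def linkage : R.G.Subgraph where
  verts := Set.univ
  Adj u v := R.G.Adj u v ∧ C.cls u = C.cls v
  adj_sub h := h.1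
  edge_vert _ := Set.mem_univ _
  symm := ⟨fun _ _ h => ⟨h.1.symm, h.2.symm⟩⟩

lemma linkage_coe_adj (u v : C.linkage.verts) : C.linkage.coe.Adj u v ↔ C.cls u = C.cls v ∧
    (C.idx u + 1 = C.idx v ∨ C.idx v + 1 = C.idx u) :=
  ⟨fun h => ⟨h.2, (C.adj_iff _ _ h.2).1 h.1⟩, fun h => ⟨(C.adj_iff _ _ h.1).2 h.2, h.1⟩⟩

lemma linkage_inj (u v : C.linkage.verts) (h : C.cls u = C.cls v) (h' : C.idx u = C.idx v) :
    u = v :=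
  Subtype.ext (C.ci_inj _ _ h h')

lemma linkage_surj (z : C.linkage.verts) (n : ℕ) (hn : n ≤ C.idx z) :
    ∃ u : C.linkage.verts, C.cls u = C.cls z ∧ C.idx u = n := by
  obtain ⟨u, hu, hu'⟩ := C.ci_surj _ (C.cls_le z) n (hn.trans_lt (C.idx_lt z))
  exact ⟨⟨u, Set.mem_univ _⟩, hu, hu'⟩

/-- The component of the canonical linkage that contains `s_i`. -/
def component (i : Fin (k + 1)) : C.linkage.coe.ConnectedComponent :=
  C.linkage.coe.connectedComponentMk ⟨R.s i, Set.mem_univ _⟩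

lemma mk_eq_component_iff (v : C.linkage.verts) (i : Fin (k + 1)) :
    C.linkage.coe.connectedComponentMk v = C.component i ↔ C.cls v = i := by
  have h := connectedComponentMk_eq_iff_cls (cls := fun v : C.linkage.verts => C.cls v)
    (idx := fun v : C.linkage.verts => C.idx v) C.linkage_inj C.linkage_coe_adj C.linkage_surj
    (x := ⟨R.s i, Set.mem_univ _⟩) (v := v) (C.s_idx i (by omega))
  rw [C.s_cls i (by omega)] at h
  exact h

lemma isPathComponent_component (i : Fin (k + 1)) :
    IsPathComponent C.linkage.coe (C.component i) ⟨R.s i, Set.mem_univ _⟩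
      ⟨R.t i, Set.mem_univ _⟩ := by
  have hs := C.s_cls i (by omega)
  have ht := C.t_cls i (by omega)
  refine isPathComponent_of_idx (cls := fun v : C.linkage.verts => C.cls v)
    (idx := fun v : C.linkage.verts => C.idx v) C.linkage_inj C.linkage_coe_adj C.linkage_surj
    (C.s_idx i (by omega)) (ht.trans hs.symm) fun u hu => ?_
  have h1 := C.idx_lt u
  have h2 := C.t_idx i (by omega)
  rw [show C.cls u = i from hu.trans hs] at h1
  show C.idx u ≤ C.idx (R.t i)
  omega

lemma component_bijective : Function.Bijective C.component := by
  constructor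
  · intro i i' h
    have h' := (C.mk_eq_component_iff ⟨R.s i, Set.mem_univ _⟩ i').1 h
    rw [C.s_cls i (by omega)] at h'
    exact Fin.ext h'
  · intro c
    induction c using ConnectedComponent.ind with
    | h v =>
    exact ⟨⟨C.cls v, Nat.lt_succ_of_le (C.cls_le v)⟩, ((C.mk_eq_component_iff v _).2 rfl).symm⟩

lemma isLinkage_linkage : IsLinkage R.G C.linkage := by
  intro c
  obtain ⟨i, rfl⟩ := C.component_bijective.2 c
  exact ⟨_, _, C.isPathComponent_component i⟩

lemma linkagePattern_linkage :
    LinkagePattern R.G C.linkage = {e | ∃ i : Fin (k + 1), e = s(R.s i, R.t i)} := by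
  ext e
  constructor
  · rintro ⟨x, y, c, hc, rfl⟩
    obtain ⟨i, rfl⟩ := C.component_bijective.2 c
    exact ⟨i, congrArg (Sym2.map Subtype.val) (hc.ends_eq (C.isPathComponent_component i))⟩
  · rintro ⟨i, rfl⟩
    exact ⟨_, _, _, C.isPathComponent_component i, rfl⟩

lemma eq_linkage {L : R.G.Subgraph} (hL : IsLinkage R.G L)
    (hp : LinkagePattern R.G L = {e | ∃ i : Fin (k + 1), e = s(R.s i, R.t i)}) :
    L = C.linkage := by
  have hex : ∀ i : Fin (k + 1), ∃ (x y : L.verts) (c : L.coe.ConnectedComponent),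
      IsPathComponent L.coe c x y ∧ s(R.s i, R.t i) = s((x : R.V), (y : R.V)) := by
    intro i
    have : s(R.s i, R.t i) ∈ LinkagePattern R.G L := hp ▸ ⟨i, rfl⟩
    exact this
  choose x y c hc hxy using hex
  choose w hw hw' hwe using fun i => (hc i).exists_walk (hxy i)
  have hcls : ∀ i i' : Fin (k + 1), s(R.s i, R.t i) = s(R.s i', R.t i') → i = i' := by
    intro i i' h
    have hs := C.s_cls i (by omega)
    have hs' := C.s_cls i' (by omega)
    have ht' := C.t_cls i' (by omega)
    rcases Sym2.eq_iff.1 h with ⟨h, -⟩ | ⟨h, -⟩ <;> rw [h] at hs <;> omega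
  have hdis : ∀ i i', i ≠ i' → ∀ a ∈ (w i).support, a ∉ (w i').support := by
    intro i i' hne a ha ha'
    have h1 := (hw i ⟨a, hw' i a ha⟩).1 ha
    have h2 := (hw i' ⟨a, hw' i a ha⟩).1 ha'
    rw [ConnectedComponent.mem_supp_iff] at h1 h2
    have hcc : c i = c i' := h1.symm.trans h2
    refine hne (hcls i i' ?_)
    rw [hxy, hxy]
    exact congrArg (Sym2.map Subtype.val) ((hcc ▸ hc i).ends_eq (hc i'))
  have hcl := C.cls_eq_of_mem_support w hdis
  have hcover : ∀ d : L.coe.ConnectedComponent, ∃ i, d = c i := by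
    intro d
    obtain ⟨a, b, hd⟩ := hL d
    have hmem : s((a : R.V), (b : R.V)) ∈ LinkagePattern R.G L := ⟨a, b, d, hd, rfl⟩
    rw [hp] at hmem
    obtain ⟨i, hi⟩ := hmem
    obtain ⟨u, -, hu, -⟩ := hd
    have ha : (a : R.V) ∈ (w i).support := by
      rcases Sym2.eq_iff.1 hi with ⟨h, -⟩ | ⟨h, -⟩ <;> rw [h]
      · exact Walk.start_mem_support _
      · exact Walk.end_mem_support _
    have h1 := (hw i a).1 ha
    have h2 := (hu a).1 u.start_mem_support
    rw [ConnectedComponent.mem_supp_iff] at h1 h2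
    exact ⟨i, h2.symm.trans h1⟩
  have hverts : ∀ v, v ∈ L.verts := by
    intro v
    let i : Fin (k + 1) := ⟨C.cls v, Nat.lt_succ_of_le (C.cls_le v)⟩
    exact hw' i v (C.mem_support_of_cls w i (hcl i) rfl)
  refine Subgraph.ext (Set.eq_univ_of_forall hverts) ?_
  ext u v
  constructor
  · intro h
    refine ⟨h.adj_sub, ?_⟩
    obtain ⟨i, hi⟩ := hcover (L.coe.connectedComponentMk ⟨u, hverts u⟩)
    have hadj : L.coe.Adj ⟨u, hverts u⟩ ⟨v, hverts v⟩ := h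
    have hv := (ConnectedComponent.connectedComponentMk_eq_of_adj hadj).symm.trans hi
    rw [hcl i u ((hw i ⟨u, hverts u⟩).2 hi), hcl i v ((hw i ⟨v, hverts v⟩).2 hv)]
  · rintro ⟨h, h'⟩
    let i : Fin (k + 1) := ⟨C.cls u, Nat.lt_succ_of_le (C.cls_le u)⟩
    rcases (C.adj_iff u v h').1 h with hi | hi
    · exact hwe i u v (C.mem_edges_of_cls w i (hcl i) rfl h'.symm hi)
    · exact (hwe i v u (C.mem_edges_of_cls w i (hcl i) h'.symm rfl hi)).symm

end GridCoords

/-- For every `k ≥ 1`, the graph `G_k = G_{k, 2^k - 1}` contains a vital linkage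
with exactly `k` components whose pattern is `{{s_1,t_1}, …, {s_k,t_k}}`. -/
theorem Gk_has_vital_linkage (k : ℕ) (hk : 1 ≤ k) :
    let R := GP (k - 1) (2 ^ k - 1) (two_pow_sub_one_pos hk)
    ∃ L : R.G.Subgraph, IsVitalLinkage R.G L ∧
      Nat.card L.coe.ConnectedComponent = k ∧
      LinkagePattern R.G L = {e | ∃ i : Fin k, e = s(R.s i, R.t i)} := by
  intro R
  obtain ⟨k, rfl⟩ : ∃ l, k = l + 1 := ⟨k - 1, by omega⟩
  let C : GridCoords k R := gridCoords k _ (two_pow_sub_one_pos hk)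
  refine ⟨C.linkage, ⟨C.isLinkage_linkage, rfl, fun L hL hp => ?_⟩, ?_, C.linkagePattern_linkage⟩
  · exact C.eq_linkage hL (hp.trans C.linkagePattern_linkage)
  · rw [← Nat.card_eq_of_bijective _ C.component_bijective, Nat.card_fin]
end

section
/- For all k,p ≥ 1, the Disjoint Paths Problem instance G_{k,p},(s_1,t_1),…,(s_k,t_k) has a solution P_1,…,P_k whose paths together use every vertex of G_{k,p}, i.e. V(P_1) ∪ … ∪ V(P_k) = V(G_{k,p}). -/
open SimpleGraph

/-- `P` is a solution of the Disjoint Paths Problem instance `G, (s 0, t 0), …, (s (k-1), t (k-1))`: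
the walks `P i` are paths, `P i` connects `s i` to `t i`, and they are pairwise vertex-disjoint. -/
def IsDPPSolution {V : Type*} (G : SimpleGraph V) {k : ℕ} {s t : Fin k → V}
    (P : (i : Fin k) → G.Walk (s i) (t i)) : Prop :=
  (∀ i, (P i).IsPath) ∧
    ∀ i j : Fin k, i ≠ j → ∀ v, v ∈ (P i).support → v ∉ (P j).support

/-- The Disjoint Paths Problem instance `G, (s 0, t 0), …, (s (k-1), t (k-1))` has a solution. -/
def HasDPPSolution {V : Type*} (G : SimpleGraph V) (k : ℕ) (s t : Fin k → V) : Prop :=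
  ∃ P : (i : Fin k) → G.Walk (s i) (t i), IsDPPSolution G P

/-- The vertex set `S` is traversed by a path of `G` from `a` to `b`. -/
def SpannedByPath {V : Type*} (G : SimpleGraph V) (a b : V) (S : Set V) : Prop :=
  ∃ w : G.Walk a b, w.IsPath ∧ ∀ v, v ∈ w.support ↔ v ∈ S

lemma SpannedByPath.map {V W : Type*} {G : SimpleGraph V} {H : SimpleGraph W} {a b : V}
    {S : Set V} (h : SpannedByPath G a b S) (f : G →g H) (hf : Function.Injective f) :
    SpannedByPath H (f a) (f b) (f '' S) := by
  obtain ⟨w, hw, hS⟩ := h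
  refine ⟨w.map f, hw.map hf, fun v => ?_⟩
  simp [Walk.support_map, hS]

lemma spannedByPath_image_Iic {V : Type*} {G : SimpleGraph V} {p : ℕ} {f : Fin p → V}
    (hf : Function.Injective f) (hadj : ∀ i j : Fin p, i.val + 1 = j.val → G.Adj (f i) (f j))
    (n : ℕ) (hn : n < p) :
    SpannedByPath G (f ⟨0, by omega⟩) (f ⟨n, hn⟩) (f '' {i | i.val ≤ n}) := by
  induction n with
  | zero =>
    refine ⟨Walk.nil, Walk.IsPath.nil, fun v => ?_⟩
    simp only [Walk.support_nil, List.mem_singleton, Set.mem_image, Set.mem_ofPred_eq]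
    constructor
    · rintro rfl
      exact ⟨_, Set.mem_ofPred.mpr (Nat.le_refl _), rfl⟩
    · rintro ⟨i, hi, rfl⟩
      exact congrArg f (Fin.ext (Nat.le_zero.mp hi))
  | succ n ih =>
    obtain ⟨w, hw, hS⟩ := ih (by omega)
    have hlast : f ⟨n + 1, hn⟩ ∉ w.support := by
      rw [hS]
      rintro ⟨i, hi, hfi⟩
      have := congrArg Fin.val (hf hfi)
      simp only [Set.mem_ofPred_eq] at hi this
      omega
    refine ⟨w.concat (hadj ⟨n, by omega⟩ ⟨n + 1, hn⟩ rfl), hw.concat hlast _, fun v => ?_⟩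
    simp only [Walk.support_concat, List.mem_append, List.mem_singleton, hS]
    constructor
    · rintro (⟨i, hi, rfl⟩ | rfl)
      · exact ⟨i, Nat.le_succ_of_le hi, rfl⟩
      · exact ⟨_, Set.mem_ofPred.mpr (Nat.le_refl _), rfl⟩
    · rintro ⟨i, hi, rfl⟩
      rcases Nat.le_succ_iff.mp hi with h | h
      · exact Or.inl ⟨i, h, rfl⟩
      · exact Or.inr (congrArg f (Fin.ext h))

lemma spannedByPath_range {V : Type*} {G : SimpleGraph V} {p : ℕ} (hp : 0 < p) {f : Fin p → V}
    (hf : Function.Injective f) (hadj : ∀ i j : Fin p, i.val + 1 = j.val → G.Adj (f i) (f j)) :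
    SpannedByPath G (f ⟨0, hp⟩) (f ⟨p - 1, by omega⟩) (Set.range f) := by
  convert spannedByPath_image_Iic hf hadj (p - 1) (by omega)
  rw [← Set.image_univ]
  congr 1
  ext i
  have := i.isLt
  simp only [Set.mem_univ, Set.mem_ofPred_eq, true_iff]
  omega

/-- The first `m` terminal pairs of `R` are joined by paths whose vertex sets `S 0, …, S (m - 1)`
partition the vertices. -/
def HasSpanningPaths {p : ℕ} (R : RowedGraph p) (m : ℕ) : Prop :=
  ∃ S : ℕ → Set R.V, (∀ i < m, SpannedByPath R.G (R.s i) (R.t i) (S i)) ∧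
    (∀ i < m, ∀ j < m, i ≠ j → Disjoint (S i) (S j)) ∧ ∀ v, ∃ i < m, v ∈ S i

lemma hasSpanningPaths_baseRG (p : ℕ) (hp : 0 < p) : HasSpanningPaths (baseRG p hp) 1 := by
  refine ⟨fun _ => Set.range id, fun i _ => ?_, fun i hi j hj hij => by omega,
    fun v => ⟨0, one_pos, v, rfl⟩⟩
  refine spannedByPath_range (f := id) hp Function.injective_id fun i j hij => ?_
  refine (SimpleGraph.fromRel_adj _ _ _).mpr ⟨fun h => ?_, Or.inl hij⟩
  have : i = j := h
  subst this
  omega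

/-- The inclusion of `R` into the graph obtained from it by adding a row. -/
def stepRGInl (k : ℕ) {p : ℕ} (hp : 0 < p) (R : RowedGraph (2 * p)) :
    R.G →g (stepRG k hp R).G where
  toFun := Sum.inl
  map_rel' h := (SimpleGraph.fromRel_adj _ _ _).mpr ⟨fun e => h.ne (Sum.inl.inj e), Or.inl h⟩

lemma HasSpanningPaths.stepRG_succ {k p : ℕ} (hp : 0 < p) {R : RowedGraph (2 * p)}
    (h : HasSpanningPaths R k) : HasSpanningPaths (stepRG k hp R) (k + 1) := by
  obtain ⟨S, hS, hdisj, hcov⟩ := h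
  have hcross : ∀ A : Set R.V,
      Disjoint (Sum.inl '' A) (Set.range (Sum.inr : Fin p → R.V ⊕ Fin p)) :=
    fun A => Set.disjoint_left.mpr (by rintro _ ⟨a, _, rfl⟩ ⟨b, hb⟩; cases hb)
  let T : ℕ → Set (stepRG k hp R).V :=
    fun i => if i < k then Sum.inl '' S i else Set.range Sum.inr
  have hT : ∀ i, i < k → T i = Sum.inl '' S i := fun i h => if_pos h
  have hT' : ∀ i, ¬ i < k → T i = Set.range Sum.inr := fun i h => if_neg h
  refine ⟨T, fun i _ => ?_, fun i hi j hj hij => ?_, ?_⟩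
  · by_cases hik : i < k
    · have hs : (stepRG k hp R).s i = Sum.inl (R.s i) := if_pos hik
      have ht : (stepRG k hp R).t i = Sum.inl (R.t i) := if_pos hik
      rw [hs, ht, hT i hik]
      exact (hS i hik).map (stepRGInl k hp R) Sum.inl_injective
    · have hs : (stepRG k hp R).s i = Sum.inr ⟨0, hp⟩ := if_neg hik
      have ht : (stepRG k hp R).t i = Sum.inr ⟨p - 1, by omega⟩ := if_neg hik
      rw [hs, ht, hT' i hik]
      refine spannedByPath_range (f := Sum.inr) hp Sum.inr_injective fun a b hab => ?_
      refine (SimpleGraph.fromRel_adj _ _ _).mpr ⟨fun e => ?_, Or.inl hab⟩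
      have := Sum.inr.inj e
      subst this
      omega
  · by_cases hik : i < k <;> by_cases hjk : j < k
    · rw [hT i hik, hT j hjk]
      exact (Set.disjoint_image_iff Sum.inl_injective).mpr (hdisj i hik j hjk hij)
    · rw [hT i hik, hT' j hjk]
      exact hcross (S i)
    · rw [hT' i hik, hT j hjk]
      exact (hcross (S j)).symm
    · omega
  · rintro (v | v)
    · obtain ⟨i, hi, hv⟩ := hcov v
      refine ⟨i, by omega, ?_⟩
      rw [hT i hi]
      exact ⟨v, hv, rfl⟩
    · refine ⟨k, k.lt_succ_self, ?_⟩
      rw [hT' k (lt_irrefl k)]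
      exact ⟨v, rfl⟩

lemma hasSpanningPaths_GP (k p : ℕ) (hp : 0 < p) : HasSpanningPaths (GP k p hp) (k + 1) := by
  induction k generalizing p with
  | zero => exact hasSpanningPaths_baseRG p hp
  | succ k ih => exact (ih (2 * p) (by omega)).stepRG_succ hp

/-- For all `k, p ≥ 1` the Disjoint Paths Problem instance
`G_{k,p}, (s_1,t_1), …, (s_k,t_k)` has a solution whose paths together use every vertex. -/
theorem Gkp_has_spanning_solution (k p : ℕ) (hk : 1 ≤ k) (hp : 1 ≤ p) :
    let R := GP (k - 1) p hp
    ∃ P : (i : Fin k) → R.G.Walk (R.s i) (R.t i),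
      IsDPPSolution R.G P ∧ ∀ v : R.V, ∃ i : Fin k, v ∈ (P i).support := by
  intro R
  obtain ⟨S, hS, hdisj, hcov⟩ := hasSpanningPaths_GP (k - 1) p hp
  rw [Nat.sub_add_cancel hk] at hS hdisj hcov
  choose P hP hPS using fun i : Fin k => hS i i.isLt
  refine ⟨P, ⟨hP, fun i j hij v hi hj => ?_⟩, fun v => ?_⟩
  · exact Set.disjoint_left.mp (hdisj i i.isLt j j.isLt (Fin.val_ne_of_ne hij))
      ((hPS i v).mp hi) ((hPS j v).mp hj)
  · obtain ⟨i, hi, hv⟩ := hcov v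
    exact ⟨⟨i, hi⟩, (hPS ⟨i, hi⟩ v).mpr hv⟩
end
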